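/- arXiv:1102.5763 — 2 statements merged into one kernel-verified Lean document; each statement's English description precedes it below -/
import Mathlib

section
/- Let μ be a finite Borel measure on ℝⁿ with all moments finite, and suppose there exists M > 0 such that for all k ∈ ℕ and all i = 1,…,n, ∫ x_i^{2k} dμ ≤ (2k)!·M. Then for a polynomial f ∈ ℝ[x], f is nonnegative on the support of μ if and only if ∫ h²·f dμ ≥ 0 for all polynomials h ∈ ℝ[x]. -/
open MeasureTheory MvPolynomial

/-- Support of a Borel measure: points all of whose open neighborhoods have
positive measure (the smallest closed set of full measure). -/
def msupport {n : ℕ} (μ : Measure (Fin n → ℝ)) : Set (Fin n → ℝ) :=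
  {x | ∀ U : Set (Fin n → ℝ), IsOpen U → x ∈ U → μ U ≠ 0}

open ProbabilityTheory

/-- Random variables with exponential moments and equal moments have complex moment generating
functions that agree on the imaginary axis. -/
lemma complexMGF_mul_I_eq_of_moments_eq {Ω Ω' : Type*} {_ : MeasurableSpace Ω}
    {_ : MeasurableSpace Ω'} {P : Measure Ω} {P' : Measure Ω'} {X : Ω → ℝ} {Y : Ω' → ℝ}
    (hX : 0 ∈ interior (integrableExpSet X P)) (hY : 0 ∈ interior (integrableExpSet Y P'))
    (h : ∀ k : ℕ, ∫ ω, X ω ^ k ∂P = ∫ ω, Y ω ^ k ∂P') (t : ℝ) :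
    complexMGF X P (t * Complex.I) = complexMGF Y P' (t * Complex.I) := by
  set S : Set ℂ :=
    Complex.re ⁻¹' (interior (integrableExpSet X P) ∩ interior (integrableExpSet Y P')) with hS
  have hSconv : Convex ℝ S :=
    (convex_integrableExpSet.interior.inter convex_integrableExpSet.interior).linear_preimage
      Complex.reLm
  have hX' : AnalyticAt ℂ (complexMGF X P) 0 := analyticAt_complexMGF (by simpa using hX)
  have hY' : AnalyticAt ℂ (complexMGF Y P') 0 := analyticAt_complexMGF (by simpa using hY)
  have hder (k : ℕ) : iteratedDeriv k (complexMGF X P) 0 = iteratedDeriv k (complexMGF Y P') 0 := by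
    rw [iteratedDeriv_complexMGF (by simpa using hX), iteratedDeriv_complexMGF (by simpa using hY)]
    simpa only [zero_mul, Complex.exp_zero, mul_one, ← Complex.ofReal_pow, integral_complex_ofReal,
      Complex.ofReal_inj] using h k
  have hev : complexMGF X P =ᶠ[nhds 0] complexMGF Y P' := by
    have h1 := hX'.hasFPowerSeriesAt
    simp_rw [hder] at h1
    filter_upwards [h1.eventually_hasSum_sub, hY'.hasFPowerSeriesAt.eventually_hasSum_sub]
      with z hz hz' using hz.unique hz'
  have hEq : Set.EqOn (complexMGF X P) (complexMGF Y P') S :=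
    AnalyticOnNhd.eqOn_of_preconnected_of_eventuallyEq
      (fun z hz ↦ analyticAt_complexMGF hz.1) (fun z hz ↦ analyticAt_complexMGF hz.2)
      hSconv.isPreconnected (z₀ := 0) (by simpa [hS] using ⟨hX, hY⟩) hev
  exact hEq (by simpa [hS] using ⟨hX, hY⟩)

section Determinacy

variable {E : Type*} [NormedAddCommGroup E] [NormedSpace ℝ E] [MeasurableSpace E] [BorelSpace E]

/-- If `exp (c‖x‖)` is integrable for some `c > 0`, every continuous linear functional has
exponential moments. -/
lemma zero_mem_interior_integrableExpSet_dual {P : Measure E} {c : ℝ} (hc : 0 < c)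
    (hP : Integrable (fun x ↦ Real.exp (c * ‖x‖)) P) (L : StrongDual ℝ E) :
    0 ∈ interior (integrableExpSet L P) := by
  rw [mem_interior_iff_mem_nhds, Metric.mem_nhds_iff]
  have hL : 0 < ‖L‖ + 1 := by positivity
  refine ⟨c / (‖L‖ + 1), by positivity, fun t ht ↦ ?_⟩
  rw [Metric.mem_ball, dist_zero_right, Real.norm_eq_abs, lt_div_iff₀ hL] at ht
  refine hP.mono' (by fun_prop) (.of_forall fun x ↦ ?_)
  rw [Real.norm_of_nonneg (Real.exp_nonneg _), Real.exp_le_exp]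
  calc t * L x ≤ |t| * ‖L x‖ := by
        rw [Real.norm_eq_abs, ← abs_mul]; exact le_abs_self _
    _ ≤ |t| * ((‖L‖ + 1) * ‖x‖) := by
        gcongr
        exact (L.le_opNorm x).trans (by gcongr; linarith)
    _ = |t| * (‖L‖ + 1) * ‖x‖ := by ring
    _ ≤ c * ‖x‖ := by gcongr

/-- Finite measures with exponential moments are determined by the moments of continuous linear
functionals. -/
lemma ext_of_moments_dual [CompleteSpace E] [SecondCountableTopology E] {P Q : Measure E}
    [IsFiniteMeasure P] [IsFiniteMeasure Q] {c : ℝ} (hc : 0 < c)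
    (hP : Integrable (fun x ↦ Real.exp (c * ‖x‖)) P)
    (hQ : Integrable (fun x ↦ Real.exp (c * ‖x‖)) Q)
    (h : ∀ (L : StrongDual ℝ E) (k : ℕ), ∫ x, L x ^ k ∂P = ∫ x, L x ^ k ∂Q) : P = Q := by
  refine Measure.ext_of_charFunDual (funext fun L ↦ ?_)
  have := complexMGF_mul_I_eq_of_moments_eq (zero_mem_interior_integrableExpSet_dual hc hP L)
    (zero_mem_interior_integrableExpSet_dual hc hQ L) (h L) 1
  simpa [complexMGF, charFunDual_apply, mul_comm] using this

end Determinacy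

lemma toNNReal_sub_toNNReal_neg (r : ℝ) : (r.toNNReal : ℝ) - ((-r).toNNReal : ℝ) = r := by
  simp only [Real.coe_toNNReal']
  rcases le_total 0 r with h | h <;> simp [h]

/-- A weight with exponential moments that is orthogonal to all polynomials vanishes almost
everywhere. -/
lemma ae_eq_zero_of_integral_mul_eval_eq_zero {n : ℕ} {μ : Measure (Fin n → ℝ)}
    [IsFiniteMeasure μ] {w : (Fin n → ℝ) → ℝ} (hw : Measurable w) {c : ℝ} (hc : 0 < c)
    (hexp : Integrable (fun x ↦ w x * Real.exp (c * ‖x‖)) μ)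
    (hint : ∀ p : MvPolynomial (Fin n) ℝ, Integrable (fun x ↦ w x * eval x p) μ)
    (horth : ∀ p : MvPolynomial (Fin n) ℝ, ∫ x, w x * eval x p ∂μ = 0) :
    w =ᵐ[μ] 0 := by
  have hpos : Measurable fun x ↦ (w x).toNNReal := hw.real_toNNReal
  have hneg : Measurable fun x ↦ (-w x).toNNReal := hw.neg.real_toNNReal
  have hdom {v g : (Fin n → ℝ) → ℝ} (hv : Measurable v) (hg : Continuous g)
      (h : Integrable (fun x ↦ v x * g x) μ) :
      Integrable (fun x ↦ ((v x).toNNReal : ℝ) * g x) μ := by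
    refine h.mono (hv.real_toNNReal.coe_nnreal_real.mul hg.measurable).aestronglyMeasurable
      (.of_forall fun x ↦ ?_)
    rw [norm_mul, norm_mul]
    gcongr
    rw [Real.norm_of_nonneg (NNReal.coe_nonneg _), Real.coe_toNNReal']
    exact max_le (le_abs_self _) (abs_nonneg _)
  have hint1 : Integrable w μ := by simpa using hint 1
  have hint_neg {g : (Fin n → ℝ) → ℝ} (h : Integrable (fun x ↦ w x * g x) μ) :
      Integrable (fun x ↦ -w x * g x) μ := by simpa using h.neg
  have : IsFiniteMeasure (μ.withDensity fun x ↦ ((w x).toNNReal : ENNReal)) :=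
    isFiniteMeasure_withDensity_ofReal hint1.2
  have : IsFiniteMeasure (μ.withDensity fun x ↦ ((-w x).toNNReal : ENNReal)) :=
    isFiniteMeasure_withDensity_ofReal hint1.neg.2
  have key : (μ.withDensity fun x ↦ ((w x).toNNReal : ENNReal)) =
      μ.withDensity fun x ↦ ((-w x).toNNReal : ENNReal) := by
    refine ext_of_moments_dual hc ?_ ?_ fun L k ↦ ?_
    · rw [integrable_withDensity_iff_integrable_smul hpos]
      exact hdom hw (by fun_prop) hexp
    · rw [integrable_withDensity_iff_integrable_smul hneg]
      exact hdom hw.neg (by fun_prop) (hint_neg hexp)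
    · rw [integral_withDensity_eq_integral_smul hpos,
        integral_withDensity_eq_integral_smul hneg]
      obtain ⟨p, hp⟩ : ∃ p : MvPolynomial (Fin n) ℝ, ∀ x, L x ^ k = eval x p := by
        refine ⟨(∑ i, C (L (Pi.single i 1)) * X i) ^ k, fun x ↦ ?_⟩
        simp only [map_pow, map_sum, map_mul, eval_C, eval_X]
        congr 1
        rw [pi_eq_sum_univ' x, map_sum]
        simp [mul_comm, Pi.single_apply]
      simp only [hp, NNReal.smul_def, smul_eq_mul]
      have hcont : Continuous fun x : Fin n → ℝ ↦ eval x p := MvPolynomial.continuous_eval p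
      have hint_pos_part := hdom hw hcont (hint p)
      have hint_neg_part : Integrable (fun x ↦ ((-w x).toNNReal : ℝ) * eval x p) μ :=
        hdom hw.neg hcont (hint_neg (hint p))
      rw [← sub_eq_zero, ← integral_sub hint_pos_part hint_neg_part, ← horth p]
      simp only [← sub_mul, toNNReal_sub_toNNReal_neg]
  rw [withDensity_eq_iff hpos.coe_nnreal_ennreal.aemeasurable
    hneg.coe_nnreal_ennreal.aemeasurable] at key
  · filter_upwards [key] with x hx
    rw [ENNReal.coe_inj] at hx
    have := toNNReal_sub_toNNReal_neg (w x)
    simp_all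
  · have := measure_lt_top (μ.withDensity fun x ↦ ((w x).toNNReal : ENNReal)) Set.univ
    rwa [withDensity_apply _ .univ, setLIntegral_univ, lt_top_iff_ne_top] at this

lemma hasSum_cosh_half (y : ℝ) :
    HasSum (fun k : ℕ ↦ (1 / 4) ^ k * (y ^ (2 * k) / (2 * k).factorial)) (Real.cosh (y / 2)) := by
  convert Real.hasSum_cosh (y / 2) using 2 with k
  rw [div_pow, div_pow, pow_mul 2 2 k]
  norm_num
  ring

/-- The factorial growth bound on even moments yields exponential moments. -/
lemma integrable_exp_half_abs {Ω : Type*} {_ : MeasurableSpace Ω} {P : Measure Ω} {X : Ω → ℝ}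
    (hX : Measurable X) {M : ℝ} (hint : ∀ k : ℕ, Integrable (fun ω ↦ X ω ^ (2 * k)) P)
    (hbound : ∀ k : ℕ, ∫ ω, X ω ^ (2 * k) ∂P ≤ (2 * k).factorial * M) :
    Integrable (fun ω ↦ Real.exp (1 / 2 * |X ω|)) P := by
  have hM : 0 ≤ M := by
    have h0 := hbound 0
    have : 0 ≤ ∫ ω, X ω ^ (2 * 0) ∂P := integral_nonneg fun ω ↦ by simp
    simp only [mul_zero, Nat.factorial_zero, Nat.cast_one, one_mul] at h0 this
    exact this.trans h0
  have hnn (k : ℕ) (ω : Ω) : 0 ≤ (1 / 4) ^ k * (X ω ^ (2 * k) / (2 * k).factorial) := by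
    have : 0 ≤ X ω ^ (2 * k) := by rw [pow_mul]; positivity
    positivity
  have hmeas : Measurable fun ω ↦ Real.cosh (X ω / 2) := by fun_prop
  have hcosh : Integrable (fun ω ↦ Real.cosh (X ω / 2)) P := by
    refine ⟨hmeas.aestronglyMeasurable, ?_⟩
    rw [hasFiniteIntegral_iff_ofReal (.of_forall fun ω ↦ (Real.cosh_pos _).le)]
    calc ∫⁻ ω, ENNReal.ofReal (Real.cosh (X ω / 2)) ∂P
        = ∫⁻ ω, ∑' k : ℕ,
            ENNReal.ofReal ((1 / 4) ^ k * (X ω ^ (2 * k) / (2 * k).factorial)) ∂P := by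
          refine lintegral_congr fun ω ↦ ?_
          rw [← ENNReal.ofReal_tsum_of_nonneg (hnn · ω) (hasSum_cosh_half _).summable,
            (hasSum_cosh_half _).tsum_eq]
      _ = ∑' k : ℕ, ∫⁻ ω,
            ENNReal.ofReal ((1 / 4) ^ k * (X ω ^ (2 * k) / (2 * k).factorial)) ∂P :=
          lintegral_tsum fun k ↦ by fun_prop
      _ ≤ ∑' k : ℕ, ENNReal.ofReal ((1 / 4) ^ k * M) := by
          refine ENNReal.tsum_le_tsum fun k ↦ ?_
          rw [← ofReal_integral_eq_lintegral_ofReal (((hint k).div_const _).const_mul _)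
            (.of_forall (hnn k)), integral_const_mul, integral_div]
          gcongr
          rw [div_le_iff₀' (by positivity)]
          exact hbound k
      _ < ⊤ := by
          rw [← ENNReal.ofReal_tsum_of_nonneg (fun k ↦ by positivity)
            ((summable_geometric_of_lt_one (by norm_num) (by norm_num)).mul_right M)]
          exact ENNReal.ofReal_lt_top
  refine (hcosh.const_mul 2).mono' (by fun_prop) (.of_forall fun ω ↦ ?_)
  rw [Real.norm_of_nonneg (Real.exp_nonneg _), ← Real.cosh_abs, Real.cosh_eq, abs_div, abs_two]
  have := Real.exp_pos (-(|X ω| / 2))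
  rw [one_div_mul_eq_div]
  linarith

lemma integrable_mvPolynomial_eval {n : ℕ} {μ : Measure (Fin n → ℝ)}
    (hmom : ∀ α : Fin n →₀ ℕ, Integrable (fun x => ∏ i, x i ^ α i) μ)
    (p : MvPolynomial (Fin n) ℝ) : Integrable (fun x ↦ eval x p) μ := by
  simp only [eval_eq']
  exact integrable_finsetSum _ fun d _ ↦ (hmom d).const_mul _

lemma integrable_exp_half_norm {n : ℕ} {μ : Measure (Fin n → ℝ)} [IsFiniteMeasure μ]
    (hmom : ∀ α : Fin n →₀ ℕ, Integrable (fun x => ∏ i, x i ^ α i) μ) {M : ℝ}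
    (hbound : ∀ (k : ℕ) (i : Fin n), ∫ x, x i ^ (2 * k) ∂μ ≤ (2 * k).factorial * M) :
    Integrable (fun x ↦ Real.exp (1 / 2 * ‖x‖)) μ := by
  have hi (i : Fin n) : Integrable (fun x : Fin n → ℝ ↦ Real.exp (1 / 2 * |x i|)) μ :=
    integrable_exp_half_abs (measurable_pi_apply i)
      (fun k ↦ by simpa using integrable_mvPolynomial_eval hmom (X i ^ (2 * k))) (hbound · i)
  refine ((integrable_const (1 : ℝ)).add (integrable_finsetSum Finset.univ fun i _ ↦ hi i)).mono'
    (by fun_prop) (.of_forall fun x ↦ ?_)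
  rw [Real.norm_of_nonneg (Real.exp_nonneg _)]
  simp only [Pi.add_apply]
  rcases isEmpty_or_nonempty (Fin n) with hn | hn
  · simp [Subsingleton.elim x 0]
  · obtain ⟨i, hi⟩ := Finite.exists_max fun i ↦ |x i|
    have hx : ‖x‖ ≤ |x i| := (pi_norm_le_iff_of_nonneg (abs_nonneg _)).2 hi
    calc Real.exp (1 / 2 * ‖x‖) ≤ Real.exp (1 / 2 * |x i|) := by gcongr
      _ ≤ ∑ j, Real.exp (1 / 2 * |x j|) :=
          Finset.single_le_sum (f := fun j ↦ Real.exp (1 / 2 * |x j|))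
            (fun j _ ↦ Real.exp_nonneg _) (Finset.mem_univ i)
      _ ≤ _ := by linarith

section Weighted

variable {n : ℕ} {μ : Measure (Fin n → ℝ)}

lemma memLp_sqrt_abs_mul_eval
    (hmom : ∀ α : Fin n →₀ ℕ, Integrable (fun x => ∏ i, x i ^ α i) μ)
    (f p : MvPolynomial (Fin n) ℝ) :
    MemLp (fun x ↦ √|eval x f| * eval x p) 2 μ := by
  have hcont (q : MvPolynomial (Fin n) ℝ) : Continuous fun x : Fin n → ℝ ↦ eval x q :=
    MvPolynomial.continuous_eval q
  refine (memLp_two_iff_integrable_sq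
    ((hcont f).abs.sqrt.mul (hcont p)).aestronglyMeasurable).2 ?_
  refine (integrable_mvPolynomial_eval hmom (f * p ^ 2)).abs.congr (.of_forall fun x ↦ ?_)
  simp [abs_mul, mul_pow, Real.sq_sqrt]

/-- The linear map sending a polynomial `p` to the class of `√|f| * p` in `L²`. -/
noncomputable def weightedToLp
    (hmom : ∀ α : Fin n →₀ ℕ, Integrable (fun x => ∏ i, x i ^ α i) μ)
    (f : MvPolynomial (Fin n) ℝ) : MvPolynomial (Fin n) ℝ →ₗ[ℝ] Lp ℝ 2 μ where
  toFun p := (memLp_sqrt_abs_mul_eval hmom f p).toLp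
  map_add' p q := by
    rw [← MemLp.toLp_add]
    exact MemLp.toLp_congr _ _ (.of_forall fun x ↦ by simp [mul_add])
  map_smul' r p := by
    rw [RingHom.id_apply, ← MemLp.toLp_const_smul]
    exact MemLp.toLp_congr _ _ (.of_forall fun x ↦ by simp [mul_left_comm])

/-- The restriction of `√|f|` to a measurable set is a limit in `L²` of functions `√|f| * h` with
`h` polynomial. -/
lemma exists_integral_indicator_sub_sq_lt [IsFiniteMeasure μ]
    (hmom : ∀ α : Fin n →₀ ℕ, Integrable (fun x => ∏ i, x i ^ α i) μ)
    (hexp : Integrable (fun x ↦ Real.exp (1 / 2 * ‖x‖)) μ) (f : MvPolynomial (Fin n) ℝ)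
    {B : Set (Fin n → ℝ)} (hB : MeasurableSet B) {ε : ℝ} (hε : 0 < ε) :
    ∃ h : MvPolynomial (Fin n) ℝ,
      Integrable (fun x ↦ (B.indicator (fun x ↦ √|eval x f|) x - √|eval x f| * eval x h) ^ 2) μ ∧
      ∫ x, (B.indicator (fun x ↦ √|eval x f|) x - √|eval x f| * eval x h) ^ 2 ∂μ < ε := by
  have hcont (q : MvPolynomial (Fin n) ℝ) : Continuous fun x : Fin n → ℝ ↦ eval x q :=
    MvPolynomial.continuous_eval q
  have hsq : MemLp (fun x ↦ √|eval x f|) 2 μ := by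
    simpa using memLp_sqrt_abs_mul_eval hmom f 1
  have hg : MemLp (B.indicator fun x ↦ √|eval x f|) 2 μ := hsq.indicator hB
  have hsqexp : MemLp (fun x ↦ √|eval x f| * Real.exp (1 / 8 * ‖x‖)) 2 μ := by
    have hcontexp : Continuous fun x : Fin n → ℝ ↦ Real.exp (1 / 8 * ‖x‖) := by fun_prop
    refine (memLp_two_iff_integrable_sq
      ((hcont f).abs.sqrt.mul hcontexp).aestronglyMeasurable).2 ?_
    have h1 : MemLp (fun x ↦ |eval x f|) 2 μ := by
      rw [memLp_two_iff_integrable_sq (hcont f).abs.aestronglyMeasurable]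
      exact (integrable_mvPolynomial_eval hmom (f ^ 2)).congr (.of_forall fun x ↦ by simp)
    have h2 : MemLp (fun x : Fin n → ℝ ↦ Real.exp (1 / 4 * ‖x‖)) 2 μ := by
      rw [memLp_two_iff_integrable_sq (by fun_prop)]
      refine hexp.congr (.of_forall fun x ↦ ?_)
      simp only [← Real.exp_nat_mul]
      congr 1
      push_cast
      ring
    refine (h1.integrable_mul h2).congr (.of_forall fun x ↦ ?_)
    simp only [Pi.mul_apply, mul_pow, Real.sq_sqrt (abs_nonneg _), ← Real.exp_nat_mul]
    congr 2
    push_cast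
    ring
  set K := LinearMap.range (weightedToLp hmom f) with hK
  have hmem : hg.toLp ∈ K.topologicalClosure := by
    rw [← Submodule.orthogonal_orthogonal_eq_closure, Submodule.mem_orthogonal]
    intro u hu
    have hu2 : MemLp u 2 μ := Lp.memLp u
    have hw : (fun x ↦ u x * √|eval x f|) =ᵐ[μ] 0 := by
      refine ae_eq_zero_of_integral_mul_eval_eq_zero (c := 1 / 8)
        ((Lp.stronglyMeasurable u).measurable.mul (hcont f).abs.sqrt.measurable)
        (by norm_num) ?_ (fun p ↦ ?_) (fun p ↦ ?_)
      · simpa only [mul_assoc, Pi.mul_def] using hu2.integrable_mul hsqexp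
      · simpa only [mul_assoc, Pi.mul_def] using
          hu2.integrable_mul (memLp_sqrt_abs_mul_eval hmom f p)
      · have h0 := (Submodule.mem_orthogonal' _ _).1 hu _ (LinearMap.mem_range_self _ p)
        rw [L2.inner_def] at h0
        rw [← h0]
        refine integral_congr_ae ?_
        filter_upwards [(memLp_sqrt_abs_mul_eval hmom f p).coeFn_toLp] with x hx
        simp only [weightedToLp, LinearMap.coe_mk, AddHom.coe_mk, hx]
        simp only [RCLike.inner_apply, conj_trivial]
        ring
    rw [L2.inner_def, ← integral_zero (Fin n → ℝ) ℝ (μ := μ)]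
    refine integral_congr_ae ?_
    filter_upwards [hw, hg.coeFn_toLp] with x hx hx'
    simp only [Pi.zero_apply] at hx
    rw [hx', RCLike.inner_apply, conj_trivial]
    by_cases hxB : x ∈ B
    · rw [Set.indicator_of_mem hxB, mul_comm, hx]
    · rw [Set.indicator_of_notMem hxB, zero_mul]
  obtain ⟨_, ⟨h, rfl⟩, hh⟩ := Metric.mem_closure_iff.1 hmem (√ε) (by positivity)
  have hd := hg.sub (memLp_sqrt_abs_mul_eval hmom f h)
  refine ⟨h, hd.integrable_sq, ?_⟩
  have hnorm : dist hg.toLp (weightedToLp hmom f h) = ‖hd.toLp‖ := by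
    rw [dist_eq_norm, MemLp.toLp_sub hg (memLp_sqrt_abs_mul_eval hmom f h)]
    rfl
  rw [hnorm, Real.lt_sqrt (norm_nonneg _), ← real_inner_self_eq_norm_sq, L2.inner_def] at hh
  refine lt_of_eq_of_lt (integral_congr_ae ?_) hh
  filter_upwards [hd.coeFn_toLp] with x hx
  rw [hx]
  simp [sq]

end Weighted

lemma msupport_eq_support {n : ℕ} (μ : Measure (Fin n → ℝ)) : msupport μ = μ.support := by
  rw [Measure.support_eq_forall_isOpen]
  ext x
  simp only [msupport, Set.mem_ofPred_eq, pos_iff_ne_zero]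
  exact ⟨fun h U hx hU ↦ h U hU hx, fun h U hU hx ↦ h U hx hU⟩

theorem stmt0 {n : ℕ} (μ : Measure (Fin n → ℝ)) [IsFiniteMeasure μ]
    (hmom : ∀ α : Fin n →₀ ℕ, Integrable (fun x => ∏ i, x i ^ α i) μ)
    (M : ℝ) (hM : 0 < M)
    (hbound : ∀ (k : ℕ) (i : Fin n), ∫ x, x i ^ (2 * k) ∂μ ≤ (2 * k).factorial * M)
    (f : MvPolynomial (Fin n) ℝ) :
    (∀ x ∈ msupport μ, 0 ≤ eval x f) ↔
      ∀ h : MvPolynomial (Fin n) ℝ, 0 ≤ ∫ x, (eval x h) ^ 2 * eval x f ∂μ := by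
  constructor
  · intro hf h
    refine integral_nonneg_of_ae ?_
    filter_upwards [Measure.support_mem_ae (μ := μ)] with x hx
    rw [← msupport_eq_support] at hx
    exact mul_nonneg (sq_nonneg _) (hf x hx)
  · intro hpos x₀ hx₀
    by_contra! hneg
    have hcont : Continuous fun x : Fin n → ℝ ↦ eval x f := MvPolynomial.continuous_eval f
    set B : Set (Fin n → ℝ) := {x | eval x f < 0} with hBdef
    have hB : IsOpen B := isOpen_lt hcont continuous_const
    have hqint : Integrable (fun x ↦ max (-eval x f) 0) μ := 
      (integrable_mvPolynomial_eval hmom f).neg.pos_part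
    have hq : 0 < ∫ x, max (-eval x f) 0 ∂μ := by
      refine (integral_pos_iff_support_of_nonneg (fun x ↦ le_max_right _ _) hqint).2 ?_
      have hsupp : (Function.support fun x ↦ max (-eval x f) 0) = B := by
        ext x
        simp [hBdef]
      exact hsupp ▸ pos_iff_ne_zero.2 (hx₀ B hB hneg)
    obtain ⟨h, hint, hlt⟩ := exists_integral_indicator_sub_sq_lt hmom
      (integrable_exp_half_norm hmom hbound) f hB.measurableSet (half_pos hq)
    have hle : ∫ x, eval x h ^ 2 * eval x f ∂μ ≤
        ∫ x, ((B.indicator (fun x ↦ √|eval x f|) x - √|eval x f| * eval x h) ^ 2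
          - max (-eval x f) 0 / 2) ∂μ := by
      refine integral_mono ((integrable_mvPolynomial_eval hmom (h ^ 2 * f)).congr
        (.of_forall fun x ↦ by simp))
        (hint.sub (hqint.div_const 2)) fun x ↦ ?_
      have hs := Real.sq_sqrt (abs_nonneg (eval x f))
      by_cases hx : x ∈ B
      · have hx' : eval x f < 0 := hx
        simp only [Set.indicator_of_mem hx, max_eq_left (neg_nonneg.2 hx'.le)]
        rw [abs_of_neg hx'] at hs ⊢
        nlinarith [mul_nonneg (neg_nonneg.2 hx'.le) (sq_nonneg (2 * eval x h - 1))]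
      · have hx' : 0 ≤ eval x f := not_lt.1 hx
        simp only [Set.indicator_of_notMem hx, max_eq_right (neg_nonpos.2 hx')]
        rw [abs_of_nonneg hx'] at hs ⊢
        rw [zero_sub, neg_sq, mul_pow, hs]
        linarith
    rw [integral_sub hint (hqint.div_const 2), integral_div] at hle
    linarith [hpos h]
end

section
/- Let K = {x ∈ ℝⁿ : g_j(x) ≥ 0, j = 1,…,m} be a basic closed semi-algebraic set (with g_0 = 1), and let y = (y_α)_{α ∈ ℕⁿ} be a real sequence such that: (i) L_y(h²·g_j) ≥ 0 for all h ∈ ℝ[x] and all j = 0,1,…,m; and (ii) there exists M > 0 with |y_α| ≤ M·(2⌈|α|/2⌉)! for all α ∈ ℕⁿ. Then y has a representing finite Borel measure supported on K, i.e., there is a finite Borel measure μ with supp μ ⊆ K and y_α = ∫ x^α dμ for all α. -/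
open MeasureTheory MvPolynomial

/-- The linear functional `L_y(f) = ∑_α f_α y_α`. -/
def Lfun {n : ℕ} (y : (Fin n →₀ ℕ) → ℝ) (f : MvPolynomial (Fin n) ℝ) : ℝ :=
  ∑ α ∈ f.support, f.coeff α * y α

section AnalyticVectors

open UniformSpace Filter Topology ComplexConjugate

theorem hasSum_inner_prod {𝕜 H : Type*} [RCLike 𝕜] [SeminormedAddCommGroup H]
    [InnerProductSpace 𝕜 H] {x y : ℕ → H} {a b : H} (hx : HasSum x a) (hy : HasSum y b)
    (hx' : Summable fun k => ‖x k‖) (hy' : Summable fun k => ‖y k‖) :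
    HasSum (fun p : ℕ × ℕ => inner 𝕜 (x p.1) (y p.2)) (inner 𝕜 a b) := by
  have hs : Summable fun p : ℕ × ℕ => inner 𝕜 (x p.1) (y p.2) :=
    Summable.of_norm_bounded
      (hx'.mul_of_nonneg hy' (fun _ => norm_nonneg _) fun _ => norm_nonneg _)
      fun p => norm_inner_le_norm _ _
  have h₁ : ∀ k, HasSum (fun l => inner 𝕜 (x k) (y l)) (inner 𝕜 (x k) b) := fun k =>
    hy.mapL (innerSL 𝕜 (x k))
  have h₂ : HasSum (fun k => inner 𝕜 (x k) b) (inner 𝕜 a b) := by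
    have := (hx.mapL (innerSL 𝕜 b)).map (starRingEnd 𝕜) RCLike.continuous_conj
    simpa [Function.comp_def, inner_conj_symm] using this
  have h₃ := hs.hasSum.prod_fiberwise h₁
  rw [h₂.unique h₃]
  exact hs.hasSum

variable {E : Type*} [SeminormedAddCommGroup E] [InnerProductSpace ℂ E]

/-- The exponential series of `i s X`, with values in the completion. -/
noncomputable def expSeries (X : Module.End ℂ E) (s : ℝ) (p : E) (k : ℕ) : Completion E :=
  ((s * Complex.I) ^ k / k.factorial : ℂ) • (((X ^ k) p : E) : Completion E)

theorem norm_expSeries_le (X : Module.End ℂ E) {t s : ℝ} (hst : |s| ≤ t) (p : E) (k : ℕ) :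
    ‖expSeries X s p k‖ ≤ t ^ k / k.factorial * ‖(X ^ k) p‖ := by
  rw [expSeries, norm_smul, Completion.norm_coe]
  gcongr
  simp only [norm_div, norm_pow, norm_mul, Complex.norm_real, Complex.norm_I, mul_one,
    RCLike.norm_natCast, Real.norm_eq_abs]
  gcongr

theorem pow_symm {X : Module.End ℂ E} (hX : ∀ p q, inner ℂ (X p) q = inner ℂ p (X q)) (k : ℕ)
    (p q : E) : inner ℂ ((X ^ k) p) q = inner ℂ p ((X ^ k) q) := by
  induction k generalizing p with
  | zero => simp
  | succ k ih => rw [pow_succ, Module.End.mul_apply, ih, hX, ← Module.End.mul_apply, ← pow_succ',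
      ← pow_succ]

theorem sum_antidiagonal_exp (s : ℝ) (m : ℕ) :
    ∑ p ∈ Finset.HasAntidiagonal.antidiagonal m, conj ((s * Complex.I) ^ p.1 / p.1.factorial : ℂ) *
      ((s * Complex.I) ^ p.2 / p.2.factorial : ℂ) = if m = 0 then 1 else 0 := by
  have h := (Commute.all (-(s * Complex.I) : ℂ) (s * Complex.I)).add_pow' m
  rw [neg_add_cancel, zero_pow_eq] at h
  have hm : ((m.factorial : ℕ) : ℂ) ≠ 0 := by exact_mod_cast m.factorial_ne_zero
  have : (if m = 0 then (1 : ℂ) else 0) = (if m = 0 then (1 : ℂ) else 0) / m.factorial := by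
    split_ifs with h <;> simp [h]
  rw [this, h, Finset.sum_div]
  refine Finset.sum_congr rfl fun p hp => ?_
  rw [Finset.HasAntidiagonal.mem_antidiagonal] at hp
  subst hp
  have h₁ : ((p.1.factorial : ℕ) : ℂ) ≠ 0 := by exact_mod_cast p.1.factorial_ne_zero
  have h₂ : ((p.2.factorial : ℕ) : ℂ) ≠ 0 := by exact_mod_cast p.2.factorial_ne_zero
  rw [Nat.choose_symm_add]
  have h₃ : ((p.1 + p.2).factorial : ℂ) =
      ((p.1 + p.2).choose p.2 : ℂ) * p.1.factorial * p.2.factorial := by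
    exact_mod_cast (Nat.add_choose_mul_factorial_mul_factorial p.1 p.2).symm
  have h₄ : ((p.1 + p.2).choose p.2 : ℂ) ≠ 0 := by
    exact_mod_cast (Nat.choose_pos (Nat.le_add_left _ _)).ne'
  simp only [map_div₀, map_pow, map_mul, Complex.conj_ofReal, Complex.conj_I, map_natCast,
    nsmul_eq_mul]
  rw [h₃]
  field_simp

theorem norm_tsum_expSeries {X : Module.End ℂ E}
    (hX : ∀ p q, inner ℂ (X p) q = inner ℂ p (X q)) {p : E} {s : ℝ}
    (hs : Summable fun k => ‖expSeries X s p k‖) :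
    ‖∑' k, expSeries X s p k‖ = ‖p‖ := by
  have h := hasSum_inner_prod (𝕜 := ℂ) hs.of_norm.hasSum hs.of_norm.hasSum hs hs
  rw [← Finset.HasAntidiagonal.sigmaAntidiagonalEquivProd.hasSum_iff] at h
  have h' := h.sigma fun m => hasSum_fintype _
  have h₀ : ∀ m, (∑ c : Finset.HasAntidiagonal.antidiagonal m, ((fun k : ℕ × ℕ =>
      inner ℂ (expSeries X s p k.1) (expSeries X s p k.2)) ∘
        Finset.HasAntidiagonal.sigmaAntidiagonalEquivProd) ⟨m, c⟩) =
          if m = 0 then inner ℂ p p else 0 := by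
    intro m
    have : ∀ c : Finset.HasAntidiagonal.antidiagonal m, ((fun k : ℕ × ℕ =>
      inner ℂ (expSeries X s p k.1) (expSeries X s p k.2)) ∘
        Finset.HasAntidiagonal.sigmaAntidiagonalEquivProd) ⟨m, c⟩ =
        conj ((s * Complex.I) ^ c.1.1 / c.1.1.factorial : ℂ) *
      ((s * Complex.I) ^ c.1.2 / c.1.2.factorial : ℂ) * inner ℂ p ((X ^ m) p) := by
      rintro ⟨⟨k, l⟩, hc⟩
      rw [Finset.HasAntidiagonal.mem_antidiagonal] at hc
      simp only at hc
      subst hc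
      simp only [Function.comp, Finset.HasAntidiagonal.sigmaAntidiagonalEquivProd_apply, expSeries]
      rw [inner_smul_left, inner_smul_right, Completion.inner_coe, pow_symm hX,
        ← Module.End.mul_apply, ← pow_add]
      ring
    rw [Finset.sum_congr rfl fun c _ => this c, ← Finset.sum_mul,
      Finset.sum_coe_sort (Finset.HasAntidiagonal.antidiagonal m) fun c : ℕ × ℕ =>
        conj ((s * Complex.I) ^ c.1 / c.1.factorial : ℂ) *
      ((s * Complex.I) ^ c.2 / c.2.factorial : ℂ), sum_antidiagonal_exp]
    split_ifs with hm <;> simp [hm]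
  simp only [h₀] at h'
  have h'' := h'.unique (hasSum_ite_eq 0 (inner ℂ p p))
  rw [@norm_eq_sqrt_re_inner ℂ, h'', ← @norm_eq_sqrt_re_inner ℂ]

/-- The coefficients of the power series of `sin (s x) / s`. -/
noncomputable def sinCoeff (s : ℝ) (k : ℕ) : ℂ :=
  (2 * s * Complex.I)⁻¹ *
    ((s * Complex.I) ^ k / k.factorial - ((-s : ℝ) * Complex.I) ^ k / k.factorial)

theorem conj_sinCoeff (s : ℝ) (k : ℕ) : conj (sinCoeff s k) = sinCoeff s k := by
  simp only [sinCoeff, map_mul, map_sub, map_div₀, map_pow, Complex.conj_ofReal, Complex.conj_I,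
    map_natCast, map_inv₀, Complex.ofReal_neg, map_ofNat, map_neg, neg_mul, mul_neg, neg_neg,
    inv_neg]
  ring

theorem sinCoeff_zero (s : ℝ) : sinCoeff s 0 = 0 := by simp [sinCoeff]

theorem sinCoeff_one {s : ℝ} (hs : s ≠ 0) : sinCoeff s 1 = 1 := by
  have : (s : ℂ) ≠ 0 := by exact_mod_cast hs
  simp only [sinCoeff, pow_one, Nat.factorial_one, Nat.cast_one, div_one, Complex.ofReal_neg]
  field_simp
  ring

theorem norm_sinCoeff_succ_le {s : ℝ} (hs : 0 < s) (k : ℕ) :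
    ‖sinCoeff s (k + 1)‖ ≤ s ^ k / (k + 1).factorial := by
  rw [sinCoeff, norm_mul]
  calc _ ≤ (2 * s)⁻¹ * (s ^ (k + 1) / (k + 1).factorial + s ^ (k + 1) / (k + 1).factorial) := by
        gcongr
        · simp [abs_of_pos hs]
        · refine (norm_sub_le _ _).trans (le_of_eq ?_)
          simp [abs_of_pos hs]
    _ = _ := by
        field_simp
        ring

theorem exists_sin_operators {X : Module.End ℂ E}
    (hX : ∀ p q, inner ℂ (X p) q = inner ℂ p (X q)) {t : ℝ} (ht : 0 < t)
    (hs : ∀ p, Summable fun k : ℕ => t ^ k / k.factorial * ‖(X ^ k) p‖) :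
    ∃ (A : ℕ → Completion E →L[ℂ] Completion E) (c : ℕ → ℕ → ℂ),
      (∀ j k, conj (c j k) = c j k) ∧
      (∀ j p, Summable fun k => ‖c j k • (((X ^ k) p : E) : Completion E)‖) ∧
      (∀ j p, HasSum (fun k => c j k • (((X ^ k) p : E) : Completion E)) (A j p)) ∧
      ∀ p : E, Tendsto (fun j => A j p) atTop (𝓝 ((X p : E) : Completion E)) := by
  have hexp : ∀ s, |s| ≤ t → ∀ p, Summable fun k => ‖expSeries X s p k‖ := fun s hst p =>
    Summable.of_nonneg_of_le (fun _ => norm_nonneg _) (norm_expSeries_le X hst p) (hs p)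
  have hpos : ∀ j : ℕ, 0 < t / (j + 1) := fun j => by positivity
  have hle : ∀ j : ℕ, t / (j + 1) ≤ t := fun j =>
    div_le_self ht.le (by linarith [(Nat.cast_nonneg j : (0 : ℝ) ≤ j)])
  have habs : ∀ j : ℕ, |t / (j + 1)| ≤ t := fun j => by rw [abs_of_pos (hpos j)]; exact hle j
  have habs' : ∀ j : ℕ, |-(t / (j + 1))| ≤ t := fun j => by rw [abs_neg]; exact habs j
  have hterm : ∀ s k p, sinCoeff s k • (((X ^ k) p : E) : Completion E) =
      (2 * s * Complex.I : ℂ)⁻¹ • (expSeries X s p k - expSeries X (-s) p k) := by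
    intro s k p
    rw [sinCoeff, expSeries, expSeries, ← sub_smul, smul_smul]
  have hsum : ∀ j : ℕ, ∀ p, Summable fun k =>
      ‖sinCoeff (t / (j + 1)) k • (((X ^ k) p : E) : Completion E)‖ := by
    intro j p
    refine Summable.of_nonneg_of_le (fun _ => norm_nonneg _) (fun k => ?_)
      (((hexp _ (habs j) p).add (hexp _ (habs' j) p)).mul_left
        ‖(2 * (t / (j + 1) : ℝ) * Complex.I : ℂ)⁻¹‖)
    rw [hterm, norm_smul]
    gcongr
    exact norm_sub_le _ _
  let T : ℕ → E →ₗ[ℂ] Completion E := fun j =>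
    { toFun := fun p => ∑' k, sinCoeff (t / (j + 1)) k • (((X ^ k) p : E) : Completion E)
      map_add' := fun p q => by
        rw [← (hsum j p).of_norm.tsum_add (hsum j q).of_norm]
        simp [Completion.coe_add, smul_add]
      map_smul' := fun a p => by
        rw [RingHom.id_apply, ← (hsum j p).of_norm.tsum_const_smul]
        simp [Completion.coe_smul, smul_comm a] }
  have hT : ∀ j p, ‖T j p‖ ≤ (t / (j + 1))⁻¹ * ‖p‖ := by
    intro j p
    have : T j p = (2 * (t / (j + 1) : ℝ) * Complex.I : ℂ)⁻¹ •
        (∑' k, expSeries X (t / (j + 1)) p k - ∑' k, expSeries X (-(t / (j + 1))) p k) := by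
      rw [← (hexp _ (habs j) p).of_norm.tsum_sub (hexp _ (habs' j) p).of_norm,
        ← ((hexp _ (habs j) p).of_norm.sub (hexp _ (habs' j) p).of_norm).tsum_const_smul]
      exact tsum_congr fun k => hterm _ _ _
    rw [this, norm_smul]
    calc _ ≤ ‖(2 * (t / (j + 1) : ℝ) * Complex.I : ℂ)⁻¹‖ * (‖p‖ + ‖p‖) := by
          gcongr
          refine (norm_sub_le _ _).trans ?_
          rw [norm_tsum_expSeries hX (hexp _ (habs j) p),
            norm_tsum_expSeries hX (hexp _ (habs' j) p)]
      _ = _ := by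
          simp only [norm_inv, norm_mul, Complex.norm_real, Complex.norm_I, Complex.norm_ofNat,
            Real.norm_eq_abs, abs_of_pos (hpos j)]
          have := hpos j
          field_simp
          ring
  have hA : ∀ j (p : E), (T j).extendOfNorm (Completion.toComplₗᵢ (𝕜 := ℂ) (E := E)).toLinearMap
      (p : Completion E) = T j p := fun j p =>
    LinearMap.extendOfNorm_eq (Completion.denseRange_coe)
      ⟨(t / (j + 1))⁻¹, fun x => by simpa using hT j x⟩ p
  refine ⟨fun j => (T j).extendOfNorm (Completion.toComplₗᵢ (𝕜 := ℂ) (E := E)).toLinearMap,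
    fun j => sinCoeff (t / (j + 1)), fun j k => conj_sinCoeff _ _, hsum, fun j p => ?_,
    fun p => ?_⟩
  · rw [hA]
    exact (hsum j p).of_norm.hasSum
  · simp only [hA]
    have hlim : ((X p : E) : Completion E) =
        ∑' k, (if k = 1 then ((X p : E) : Completion E) else 0) := by
      rw [tsum_ite_eq]
    rw [hlim]
    refine tendsto_tsum_of_dominated_convergence (((hs p).mul_left t⁻¹)) (fun k => ?_)
      (Eventually.of_forall fun j k => ?_)
    · rcases k with _ | _ | k
      · simp [sinCoeff_zero]
      · simp only [zero_add, if_true, pow_one]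
        refine tendsto_const_nhds.congr fun j => ?_
        rw [sinCoeff_one (hpos j).ne', one_smul]
      · have h0 : Tendsto (fun j : ℕ => t / ((j : ℝ) + 1)) atTop (𝓝 0) :=
          tendsto_const_div_atTop_nhds_zero_nat t |>.comp (tendsto_add_atTop_nat 1) |>.congr
            fun j => by simp
        have h1 : Tendsto (fun j : ℕ => sinCoeff (t / (j + 1)) (k + 2)) atTop (𝓝 0) := by
          refine squeeze_zero_norm (fun j => norm_sinCoeff_succ_le (hpos j) (k + 1)) ?_
          simpa using (h0.pow (k + 1)).div_const ((k + 1 + 1).factorial : ℝ)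
        simpa using h1.smul_const (((X ^ (k + 2)) p : E) : Completion E)
    · rcases k with _ | k
      · simp only [sinCoeff_zero, zero_smul, norm_zero]
        positivity
      · rw [norm_smul, Completion.norm_coe]
        calc _ ≤ (t ^ k / (k + 1).factorial) * ‖(X ^ (k + 1)) p‖ := by
              gcongr
              refine (norm_sinCoeff_succ_le (hpos j) k).trans ?_
              gcongr
              exact hle j
          _ = _ := by
              field_simp
              ring

theorem ext_inner_completion {A B : Completion E →L[ℂ] Completion E}
    (h : ∀ p q : E, inner ℂ (A p) (q : Completion E) = inner ℂ (B p) (q : Completion E)) :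
    A = B := by
  ext1 x
  refine Completion.induction_on (p := fun x => A x = B x) x
    (isClosed_eq (by fun_prop) (by fun_prop)) fun p => ?_
  refine ext_inner_right ℂ fun y => ?_
  exact Completion.induction_on (p := fun y => inner ℂ (A p) y = inner ℂ (B p) y) y
    (isClosed_eq (by fun_prop) (by fun_prop)) (h p)

variable {X Y : Module.End ℂ E} {A B : Completion E →L[ℂ] Completion E} {a b : ℕ → ℂ}

theorem isSelfAdjoint_of_hasSum (hX : ∀ p q, inner ℂ (X p) q = inner ℂ p (X q))
    (ha : ∀ k, conj (a k) = a k)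
    (hA : ∀ p : E, HasSum (fun k => a k • (((X ^ k) p : E) : Completion E)) (A p)) :
    IsSelfAdjoint A := by
  rw [ContinuousLinearMap.isSelfAdjoint_iff']
  refine (ext_inner_completion fun p q => ?_).symm
  rw [ContinuousLinearMap.adjoint_inner_left]
  have h1 := ((innerSL ℂ (q : Completion E)).hasSum (hA p)).star
  have h2 := (innerSL ℂ (p : Completion E)).hasSum (hA q)
  simp only [innerSL_apply_apply, RCLike.star_def, inner_conj_symm] at h1 h2
  refine h1.unique (h2.congr_fun fun k => ?_)
  rw [inner_smul_left, inner_smul_right, ha, Completion.inner_coe, Completion.inner_coe,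
    pow_symm hX]

theorem commute_of_hasSum (hX : ∀ p q, inner ℂ (X p) q = inner ℂ p (X q))
    (hY : ∀ p q, inner ℂ (Y p) q = inner ℂ p (Y q)) (hXY : Commute X Y)
    (ha : ∀ k, conj (a k) = a k) (hb : ∀ k, conj (b k) = b k)
    (hA : ∀ p : E, HasSum (fun k => a k • (((X ^ k) p : E) : Completion E)) (A p))
    (hB : ∀ p : E, HasSum (fun k => b k • (((Y ^ k) p : E) : Completion E)) (B p))
    (hA' : ∀ p, Summable fun k => ‖a k • (((X ^ k) p : E) : Completion E)‖)
    (hB' : ∀ p, Summable fun k => ‖b k • (((Y ^ k) p : E) : Completion E)‖) :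
    A * B = B * A := by
  have hAs := isSelfAdjoint_of_hasSum hX ha hA
  have hBs := isSelfAdjoint_of_hasSum hY hb hB
  rw [ContinuousLinearMap.isSelfAdjoint_iff'] at hAs hBs
  refine ext_inner_completion fun p q => ?_
  rw [mul_apply_eq_comp, mul_apply_eq_comp, ← A.adjoint_inner_right,
    ← B.adjoint_inner_right (A p), hAs, hBs]
  have h1 := hasSum_inner_prod (𝕜 := ℂ) (hB p) (hA q) (hB' p) (hA' q)
  have h2 := hasSum_inner_prod (𝕜 := ℂ) (hA p) (hB q) (hA' p) (hB' q)
  rw [← (Equiv.prodComm ℕ ℕ).hasSum_iff] at h2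
  refine h1.unique (h2.congr_fun fun k => ?_)
  simp only [Function.comp_apply, Equiv.prodComm_apply, Prod.fst_swap, Prod.snd_swap,
    inner_smul_left, inner_smul_right, ha, hb, Completion.inner_coe]
  rw [← pow_symm hX, ← pow_symm hY, ← Module.End.mul_apply, ← Module.End.mul_apply,
    (hXY.pow_pow k.2 k.1).eq]
  ring

end AnalyticVectors

section AENonneg

open Filter

theorem outerRegular_withDensity {Ω : Type*} [TopologicalSpace Ω] [MeasurableSpace Ω] [BorelSpace Ω]
    {P : Measure Ω} [IsFiniteMeasure P] [P.OuterRegular] {f : Ω → ENNReal}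
    (hf : ∫⁻ x, f x ∂P ≠ ⊤) : (P.withDensity f).OuterRegular := by
  refine ⟨fun A hA r hr => ?_⟩
  have hpos : r - P.withDensity f A ≠ 0 := (tsub_pos_of_lt hr).ne'
  obtain ⟨δ, hδ, h⟩ := exists_pos_setLIntegral_lt_of_measure_lt hf hpos
  obtain ⟨U, hAU, hU, -, hlt⟩ := hA.exists_isOpen_sdiff_lt (measure_ne_top P A) hδ.ne'
  refine ⟨U, hAU, hU, ?_⟩
  have hfin : P.withDensity f A ≠ ⊤ := (hr.trans_le le_top).ne
  calc P.withDensity f U ≤ P.withDensity f A + P.withDensity f (U \ A) := by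
        rw [measure_add_sdiff hA.nullMeasurableSet, Set.union_eq_self_of_subset_left hAU]
    _ < P.withDensity f A + (r - P.withDensity f A) := by
        rw [withDensity_apply f (hU.measurableSet.diff hA)]
        exact ENNReal.add_lt_add_left hfin (h _ hlt)
    _ = r := add_tsub_cancel_of_le hr.le

theorem ae_nonneg_of_forall_integral_sq_mul {Ω : Type*} [TopologicalSpace Ω] [CompactSpace Ω]
    [T2Space Ω] [MeasurableSpace Ω] [BorelSpace Ω] {P : Measure Ω} [IsFiniteMeasure P] [P.Regular]
    {g : Ω → ℝ} (hgm : Measurable g) (hg : Integrable g P)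
    (h : ∀ f : C(Ω, ℝ), 0 ≤ ∫ x, f x ^ 2 * g x ∂P) : 0 ≤ᵐ[P] g := by
  have hpos : ∫⁻ x, ENNReal.ofReal (g x) ∂P ≠ ⊤ := hg.lintegral_lt_top.ne
  have hneg : ∫⁻ x, ENNReal.ofReal (-g x) ∂P ≠ ⊤ := hg.neg.lintegral_lt_top.ne
  have hfin₁ := isFiniteMeasure_withDensity hpos
  have hfin₂ := isFiniteMeasure_withDensity hneg
  have hreg := outerRegular_withDensity hpos
  have hint : ∀ f : C(Ω, ℝ), Integrable (fun x => f x * g x) P := fun f =>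
    hg.bdd_mul f.continuous.aestronglyMeasurable (Eventually.of_forall f.norm_coe_le_norm)
  have hint' : ∀ f : CompactlySupportedContinuousMap Ω ℝ, Integrable (fun x => f x * g x) P :=
    fun f => hint f.toContinuousMap
  let Λ : CompactlySupportedContinuousMap Ω ℝ →ₚ[ℝ] ℝ :=
  { toFun := fun f => ∫ x, f x * g x ∂P
    map_add' := fun f k => by
      rw [← integral_add (hint' f) (hint' k)]
      simp [add_mul]
    map_smul' := fun c f => by
      rw [RingHom.id_apply, smul_eq_mul, ← integral_const_mul]
      simp [mul_assoc]
    monotone' := fun f k hfk => by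
      have hs : ∀ x, √(k x - f x) ^ 2 = k x - f x := fun x =>
        Real.sq_sqrt (sub_nonneg.mpr (hfk x))
      have := h ⟨fun x => √(k x - f x), by fun_prop⟩
      simp only [ContinuousMap.coe_mk, hs, sub_mul] at this
      rw [integral_sub (hint' k) (hint' f)] at this
      exact sub_nonneg.mp this }
  have key : ∀ f : CompactlySupportedContinuousMap Ω ℝ,
      ∫ x, f x ∂(P.withDensity (fun x => ENNReal.ofReal (-g x)) + RealRMK.rieszMeasure Λ) ≤
        ∫ x, f x ∂(P.withDensity fun x => ENNReal.ofReal (g x)) := by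
    intro f
    have hf : ∀ (μ : Measure Ω) [IsFiniteMeasure μ], Integrable f μ := fun μ _ =>
      f.continuous.integrable_of_hasCompactSupport f.hasCompactSupport
    rw [integral_add_measure (hf _) (hf _), RealRMK.integral_rieszMeasure,
      integral_withDensity_eq_integral_toReal_smul (by fun_prop)
        (Eventually.of_forall fun x => ENNReal.ofReal_lt_top),
      integral_withDensity_eq_integral_toReal_smul (by fun_prop)
        (Eventually.of_forall fun x => ENNReal.ofReal_lt_top)]
    change _ + ∫ x, f x * g x ∂P ≤ _
    have hm : ∀ x, (ENNReal.ofReal (g x)).toReal • f x =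
        (ENNReal.ofReal (-g x)).toReal • f x + f x * g x := fun x => by
      simp only [ENNReal.toReal_ofReal', smul_eq_mul]
      rcases le_total 0 (g x) with h0 | h0
      · rw [max_eq_left h0, max_eq_right (by linarith)]; ring
      · rw [max_eq_right h0, max_eq_left (by linarith)]; ring
    simp only [hm]
    rw [integral_add ?_ (hint' f)]
    simp only [ENNReal.toReal_ofReal', smul_eq_mul]
    exact hg.neg.pos_part.mul_bdd f.continuous.aestronglyMeasurable
      (Eventually.of_forall f.toContinuousMap.norm_coe_le_norm)
  have hmeas : MeasurableSet {x | g x < 0} := measurableSet_lt hgm measurable_const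
  have hK : ∀ K ⊆ {x | g x < 0}, IsCompact K → P K ≤ 0 := by
    intro K hKs hKc
    have h1 := (Measure.le_add_right le_rfl K).trans
      (RealRMK.measure_le_of_isCompact_of_integral key hKc)
    rw [withDensity_apply _ hKc.measurableSet, withDensity_apply _ hKc.measurableSet,
      setLIntegral_congr_fun hKc.measurableSet
        (fun x hx => ENNReal.ofReal_of_nonpos (hKs hx).le), lintegral_zero, nonpos_iff_eq_zero,
      setLIntegral_eq_zero_iff hKc.measurableSet (by fun_prop)] at h1
    rw [nonpos_iff_eq_zero, ← compl_compl K]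
    filter_upwards [h1] with x hx hxK
    exact absurd (hx hxK) (by simpa using hKs hxK)
  have h0 : P {x | g x < 0} = 0 := by
    rw [hmeas.measure_eq_iSup_isCompact_of_ne_top (measure_ne_top _ _)]
    simpa using fun K hKs hKc => hK K hKs hKc
  filter_upwards [measure_eq_zero_iff_ae_notMem.mp h0] with x hx
  simpa using hx

end AENonneg

section JointSpectralMeasure

universe u

open Filter Topology ComplexConjugate

variable {H : Type u} [NormedAddCommGroup H] [InnerProductSpace ℂ H] [CompleteSpace H]

/-- The inclusion of the real continuous functions in the complex ones. -/
def ofRealC {Ω : Type*} [TopologicalSpace Ω] (f : C(Ω, ℝ)) : C(Ω, ℂ) :=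
  ⟨fun x => (f x : ℂ), by fun_prop⟩

/-- Gelfand duality, composed with a representation `j` of the algebra. -/
theorem exists_gelfand_representation {C : Type u} [CommCStarAlgebra C] {A : Type*} [Semiring A]
    [Algebra ℂ A] [Star A] (j : C →⋆ₐ[ℂ] A) :
    ∃ (Ω : Type u) (_ : TopologicalSpace Ω) (_ : CompactSpace Ω) (_ : T2Space Ω)
      (Φ : C(Ω, ℂ) →⋆ₐ[ℂ] A),
      (∀ b, IsSelfAdjoint b → ∃ f : C(Ω, ℝ), Φ (ofRealC f) = j b) ∧ ∀ f, ∃ b, Φ f = j b := by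
  let G := gelfandStarTransform C
  refine ⟨WeakDual.characterSpace ℂ C, inferInstance, inferInstance, inferInstance,
    j.comp (G.symm : _ →⋆ₐ[ℂ] C), fun b hb => ?_, fun f => ⟨G.symm f, rfl⟩⟩
  have hsa : star (G b) = G b := by rw [← map_star, hb.star_eq]
  refine ⟨⟨fun x => (G b x).re, by fun_prop⟩, ?_⟩
  have : ofRealC ⟨fun x => (G b x).re, by fun_prop⟩ = G b := by
    ext x
    exact Complex.conj_eq_iff_re.mp (DFunLike.congr_fun hsa x)
  rw [this]
  exact congrArg j (G.symm_apply_apply b)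

theorem exists_continuous_functional_calculus (S : Set (H →L[ℂ] H))
    (hS : ∀ a ∈ S, IsSelfAdjoint a) (hc : ∀ a ∈ S, ∀ b ∈ S, a * b = b * a) :
    ∃ (Ω : Type u) (_ : TopologicalSpace Ω) (_ : CompactSpace Ω) (_ : T2Space Ω)
      (Φ : C(Ω, ℂ) →⋆ₐ[ℂ] (H →L[ℂ] H)),
      (∀ a ∈ S, ∃ f : C(Ω, ℝ), Φ (ofRealC f) = a) ∧
      ∀ f, Φ f ∈ closure (Algebra.adjoin ℂ S : Set (H →L[ℂ] H)) := by
  let B : StarSubalgebra ℂ (H →L[ℂ] H) := (StarAlgebra.adjoin ℂ S).topologicalClosure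
  have hB : IsClosed (B : Set (H →L[ℂ] H)) := StarSubalgebra.isClosed_topologicalClosure _
  have hcomm : IsMulCommutative (StarAlgebra.adjoin ℂ S) :=
    StarAlgebra.isMulCommutative_adjoin ℂ hc fun a ha b hb => by
      rw [(hS b hb).star_eq]; exact hc a ha b hb
  have hmul : ∀ x y : B, x * y = y * x :=
    (StarSubalgebra.commRingTopologicalClosure _ fun x y => mul_comm' x y).mul_comm
  let _ : CommCStarAlgebra B := { (StarSubalgebra.cstarAlgebra B : CStarAlgebra B) with
    mul_comm := hmul }
  obtain ⟨Ω, i₁, i₂, i₃, Φ, h₁, h₂⟩ := exists_gelfand_representation B.subtype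
  refine ⟨Ω, i₁, i₂, i₃, Φ, fun a ha => ?_, fun f => ?_⟩
  · exact h₁ ⟨a, StarSubalgebra.le_topologicalClosure _ (StarAlgebra.subset_adjoin ℂ S ha)⟩
      (Subtype.ext (hS a ha))
  · obtain ⟨b, hb⟩ := h₂ f
    have hstar : star S = S := by
      ext a
      refine ⟨fun ha => ?_, fun ha => by rwa [Set.mem_star, (hS a ha).star_eq]⟩
      have := hS _ ha
      rw [isSelfAdjoint_iff, star_star] at this
      rwa [this]
    have hadj := StarAlgebra.adjoin_toSubalgebra ℂ S
    rw [hstar, Set.union_self] at hadj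
    rw [hb, ← hadj]
    exact b.2

variable {Ω : Type*} [TopologicalSpace Ω] [CompactSpace Ω] [T2Space Ω] [MeasurableSpace Ω]
  [BorelSpace Ω]

theorem exists_measure_of_starAlgHom (Φ : C(Ω, ℂ) →⋆ₐ[ℂ] (H →L[ℂ] H)) (e : H) :
    ∃ P : Measure Ω, IsFiniteMeasure P ∧ P.Regular ∧
      ∀ f : C(Ω, ℝ), ∫ x, f x ∂P = (inner ℂ e (Φ (ofRealC f) e)).re := by
  have hsq : ∀ f : C(Ω, ℝ), (∀ x, 0 ≤ f x) → 0 ≤ (inner ℂ e (Φ (ofRealC f) e)).re := by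
    intro f hf
    have h : ofRealC f = star (ofRealC ⟨fun x => √(f x), by fun_prop⟩) *
        ofRealC ⟨fun x => √(f x), by fun_prop⟩ := by
      ext x
      simp only [ofRealC, ContinuousMap.coe_mk, ContinuousMap.mul_apply, ContinuousMap.star_apply,
        RCLike.star_def, Complex.conj_ofReal]
      exact_mod_cast (Real.mul_self_sqrt (hf x)).symm
    rw [h, map_mul, map_star, ContinuousLinearMap.star_eq_adjoint,
      mul_apply_eq_comp, ContinuousLinearMap.adjoint_inner_right]
    exact inner_self_nonneg (𝕜 := ℂ)
  have hadd : ∀ f g : C(Ω, ℝ), ofRealC (f + g) = ofRealC f + ofRealC g := fun f g => by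
    ext x; simp [ofRealC]
  have hsmul : ∀ (c : ℝ) (f : C(Ω, ℝ)), ofRealC (c • f) = (c : ℂ) • ofRealC f := fun c f => by
    ext x; simp [ofRealC]
  let L : C(Ω, ℝ) → ℝ := fun f => (inner ℂ e (Φ (ofRealC f) e)).re
  have Ladd : ∀ f g, L (f + g) = L f + L g := fun f g => by simp [L, hadd]
  have Lsmul : ∀ (c : ℝ) f, L (c • f) = c * L f := fun c f => by
    have : Φ ((c : ℂ) • ofRealC f) = (c : ℂ) • Φ (ofRealC f) := map_smul _ _ _
    simp only [L, hsmul, this, _root_.smul_apply, inner_smul_right, Complex.re_ofReal_mul]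
  let Λ : CompactlySupportedContinuousMap Ω ℝ →ₚ[ℝ] ℝ :=
  { toFun := fun f => L f.toContinuousMap
    map_add' := fun f g => Ladd _ _
    map_smul' := fun c f => Lsmul _ _
    monotone' := fun f g hfg => by
      have h1 : g.toContinuousMap = f.toContinuousMap + (g.toContinuousMap - f.toContinuousMap) := by
        abel
      change L _ ≤ L _
      rw [h1, Ladd]
      have := hsq (g.toContinuousMap - f.toContinuousMap) fun x => sub_nonneg.mpr (hfg x)
      simp only [L] at this ⊢
      linarith }
  refine ⟨RealRMK.rieszMeasure Λ, inferInstance, inferInstance, fun f => ?_⟩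
  exact RealRMK.integral_rieszMeasure Λ ⟨f, HasCompactSupport.of_compactSpace _⟩

theorem exists_spectral_isometry (Φ : C(Ω, ℂ) →⋆ₐ[ℂ] (H →L[ℂ] H)) (e : H) :
    ∃ P : Measure Ω, ∃ _ : IsFiniteMeasure P, P.Regular ∧ ∃ V : Lp ℂ 2 P →ₗᵢ[ℂ] H,
      ∀ f : C(Ω, ℂ), V (ContinuousMap.toLp 2 P ℂ f) = Φ f e := by
  obtain ⟨P, hP, hreg, hint⟩ := exists_measure_of_starAlgHom Φ e
  have hnorm : ∀ f : C(Ω, ℂ), ‖Φ f e‖ = ‖ContinuousMap.toLp 2 P ℂ f‖ := by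
    intro f
    rw [← sq_eq_sq₀ (norm_nonneg _) (norm_nonneg _), @norm_sq_eq_re_inner ℂ,
      @norm_sq_eq_re_inner ℂ, ContinuousMap.inner_toLp, ← ContinuousLinearMap.adjoint_inner_right,
      ← mul_apply_eq_comp, ← ContinuousLinearMap.star_eq_adjoint, ← map_star, ← map_mul]
    have h1 : star f * f = ofRealC ⟨fun x => Complex.normSq (f x), by fun_prop⟩ := by
      ext x
      simp [ofRealC, Complex.normSq_eq_conj_mul_self]
    have h2 : ∀ x, f x * (starRingEnd ℂ) (f x) = (Complex.normSq (f x) : ℂ) := fun x =>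
      Complex.mul_conj _
    rw [h1]
    simp only [h2, integral_complex_ofReal]
    exact (hint ⟨fun x => Complex.normSq (f x), by fun_prop⟩).symm
  let T : C(Ω, ℂ) →ₗ[ℂ] H :=
  { toFun := fun f => Φ f e
    map_add' := fun f g => by simp
    map_smul' := fun c f => by simp }
  have hdense : DenseRange (ContinuousMap.toLp 2 P ℂ : C(Ω, ℂ) →L[ℂ] Lp ℂ 2 P) :=
    ContinuousMap.toLp_denseRange ℂ P ℂ (by simp)
  have hV : ∀ f, T.extendOfNorm (ContinuousMap.toLp 2 P ℂ : C(Ω, ℂ) →L[ℂ] Lp ℂ 2 P).toLinearMap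
      (ContinuousMap.toLp 2 P ℂ f) = Φ f e := fun f =>
    LinearMap.extendOfNorm_eq (f := T)
      (e := (ContinuousMap.toLp 2 P ℂ : C(Ω, ℂ) →L[ℂ] Lp ℂ 2 P).toLinearMap) hdense
      ⟨1, fun x => by rw [one_mul]; exact (hnorm x).le⟩ f
  refine ⟨P, hP, hreg, ⟨(T.extendOfNorm
    (ContinuousMap.toLp 2 P ℂ : C(Ω, ℂ) →L[ℂ] Lp ℂ 2 P).toLinearMap).toLinearMap, fun u => ?_⟩,
    hV⟩
  have := hdense.induction_on (p := fun u => ‖T.extendOfNorm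
    (ContinuousMap.toLp 2 P ℂ : C(Ω, ℂ) →L[ℂ] Lp ℂ 2 P).toLinearMap u‖ = ‖u‖) u
    (isClosed_eq (by fun_prop) (by fun_prop)) (fun f => by rw [hV, hnorm])
  exact this

/-- The isometry of `exists_spectral_isometry` intertwines multiplication with the calculus. -/
theorem spectral_isometry_mul {Φ : C(Ω, ℂ) →⋆ₐ[ℂ] (H →L[ℂ] H)} {e : H} {P : Measure Ω}
    [IsFiniteMeasure P] [P.Regular] {V : Lp ℂ 2 P →ₗᵢ[ℂ] H}
    (hV : ∀ f : C(Ω, ℂ), V (ContinuousMap.toLp 2 P ℂ f) = Φ f e) (a : C(Ω, ℂ))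
    {u w : Lp ℂ 2 P} (hw : w =ᵐ[P] fun x => a x * u x) : V w = Φ a (V u) := by
  have hdense : DenseRange (ContinuousMap.toLp 2 P ℂ : C(Ω, ℂ) →L[ℂ] Lp ℂ 2 P) :=
    ContinuousMap.toLp_denseRange ℂ P ℂ (by simp)
  obtain ⟨f, hfr, hf⟩ := mem_closure_iff_seq_limit.mp (hdense u)
  choose g hg using hfr
  have h1 : Tendsto (fun n => V (f n)) atTop (𝓝 (V u)) := (V.continuous.tendsto _).comp hf
  have h2 : Tendsto (fun n => Φ a (V (f n))) atTop (𝓝 (Φ a (V u))) :=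
    ((Φ a).continuous.tendsto _).comp h1
  have h3 : ∀ n, Φ a (V (f n)) = V (ContinuousMap.toLp 2 P ℂ (a * g n)) := fun n => by
    rw [hV, map_mul, ← hg, hV]; rfl
  have h4 : Tendsto (fun n => ContinuousMap.toLp 2 P ℂ (a * g n)) atTop (𝓝 w) := by
    rw [tendsto_iff_norm_sub_tendsto_zero]
    refine squeeze_zero (fun _ => norm_nonneg _) (g := fun n => ‖a‖ * ‖f n - u‖) (fun n => ?_) ?_
    · refine Lp.norm_le_mul_norm_of_ae_le_mul ?_
      filter_upwards [hw, Lp.coeFn_sub (ContinuousMap.toLp 2 P ℂ (a * g n)) w,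
        Lp.coeFn_sub (f n) u, ContinuousMap.coeFn_toLp (p := 2) (𝕜 := ℂ) P (a * g n),
        ContinuousMap.coeFn_toLp (p := 2) (𝕜 := ℂ) P (g n)] with x k1 k2 k3 k4 k5
      rw [hg] at k5
      rw [k2, k3, Pi.sub_apply, Pi.sub_apply, k4, k1, k5, ContinuousMap.mul_apply,
        ← mul_sub, norm_mul]
      gcongr
      exact a.norm_coe_le_norm x
    · simpa using (tendsto_iff_norm_sub_tendsto_zero.mp hf).const_mul ‖a‖
  refine tendsto_nhds_unique ((V.continuous.tendsto _).comp h4) ?_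
  simpa only [Function.comp_def, ← h3] using h2

theorem exists_spectral_preimage_of_tendsto {Φ : C(Ω, ℂ) →⋆ₐ[ℂ] (H →L[ℂ] H)} {e : H}
    {P : Measure Ω} [IsFiniteMeasure P] [P.Regular] {V : Lp ℂ 2 P →ₗᵢ[ℂ] H}
    (hV : ∀ f : C(Ω, ℂ), V (ContinuousMap.toLp 2 P ℂ f) = Φ f e) {a : ℕ → C(Ω, ℂ)}
    {u : Lp ℂ 2 P} {v : H} (h : Tendsto (fun k => Φ (a k) (V u)) atTop (𝓝 v)) :
    ∃ w : Lp ℂ 2 P, V w = v ∧ TendstoInMeasure P (fun k x => a k x * u x) atTop w := by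
  have hmem : ∀ k, MemLp (fun x => a k x * u x) 2 P := fun k =>
    (Lp.memLp u).of_le_mul (c := ‖a k‖)
      ((a k).continuous.aestronglyMeasurable.mul (Lp.aestronglyMeasurable u))
      (Eventually.of_forall fun x => by
        rw [norm_mul]
        gcongr
        exact (a k).norm_coe_le_norm x)
  have hw : ∀ k, V (hmem k).toLp = Φ (a k) (V u) := fun k =>
    spectral_isometry_mul hV (a k) (hmem k).coeFn_toLp
  simp only [← hw] at h
  obtain ⟨w, rfl⟩ := V.isometry.isClosedEmbedding.isClosed_range.mem_of_tendsto h
    (Eventually.of_forall fun k => ⟨_, rfl⟩)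
  refine ⟨w, rfl, ?_⟩
  have hlim := V.isometry.isClosedEmbedding.tendsto_nhds_iff.mpr h
  exact (tendstoInMeasure_of_tendsto_Lp hlim).congr_left fun k => (hmem k).coeFn_toLp

theorem spectral_isometry_mul_of_tendsto {Φ : C(Ω, ℂ) →⋆ₐ[ℂ] (H →L[ℂ] H)} {e : H}
    {P : Measure Ω} [IsFiniteMeasure P] [P.Regular] {V : Lp ℂ 2 P →ₗᵢ[ℂ] H}
    (hV : ∀ f : C(Ω, ℂ), V (ContinuousMap.toLp 2 P ℂ f) = Φ f e) {a : ℕ → C(Ω, ℂ)}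
    {x : Ω → ℂ} (hx : TendstoInMeasure P (fun k => ⇑(a k)) atTop x)
    {u : Lp ℂ 2 P} {v : H} (h : Tendsto (fun k => Φ (a k) (V u)) atTop (𝓝 v)) :
    ∃ w : Lp ℂ 2 P, V w = v ∧ w =ᵐ[P] fun ω => x ω * u ω := by
  obtain ⟨φ, hφ, hφx⟩ := hx.exists_seq_tendsto_ae
  obtain ⟨w, hw, hlim⟩ := exists_spectral_preimage_of_tendsto hV (h.comp hφ.tendsto_atTop)
  obtain ⟨ψ, hψ, hψw⟩ := hlim.exists_seq_tendsto_ae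
  refine ⟨w, hw, ?_⟩
  filter_upwards [hφx, hψw] with ω h1 h2
  exact tendsto_nhds_unique h2 ((h1.comp hψ.tendsto_atTop).mul_const _)

/-- A strong limit at the cyclic vector of the calculus of real functions is given by a real
measurable function. -/
theorem exists_real_limit_of_tendsto {Φ : C(Ω, ℂ) →⋆ₐ[ℂ] (H →L[ℂ] H)} {e : H}
    {P : Measure Ω} [IsFiniteMeasure P] [P.Regular] {V : Lp ℂ 2 P →ₗᵢ[ℂ] H}
    (hV : ∀ f : C(Ω, ℂ), V (ContinuousMap.toLp 2 P ℂ f) = Φ f e) {f : ℕ → C(Ω, ℝ)} {v : H}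
    (h : Tendsto (fun k => Φ (ofRealC (f k)) e) atTop (𝓝 v)) :
    ∃ x : Ω → ℝ, Measurable x ∧
      TendstoInMeasure P (fun k => ⇑(ofRealC (f k))) atTop fun ω => (x ω : ℂ) := by
  have h1 : V (ContinuousMap.toLp 2 P ℂ 1) = e := by simp [hV]
  rw [← h1] at h
  obtain ⟨w, -, hw⟩ := exists_spectral_preimage_of_tendsto hV h
  have hone : (ContinuousMap.toLp 2 P ℂ (1 : C(Ω, ℂ)) : Ω → ℂ) =ᵐ[P] fun _ => 1 :=
    ContinuousMap.coeFn_toLp (p := 2) (𝕜 := ℂ) P (1 : C(Ω, ℂ))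
  have hw' : TendstoInMeasure P (fun k => ⇑(ofRealC (f k))) atTop w :=
    hw.congr_left fun k => by
      filter_upwards [hone] with ω hω
      rw [hω, mul_one]
  refine ⟨fun ω => (w ω).re, (Lp.stronglyMeasurable w).measurable.re, hw'.congr_right ?_⟩
  obtain ⟨φ, -, hφ⟩ := hw'.exists_seq_tendsto_ae
  filter_upwards [hφ] with ω hω
  have h2 := ((Complex.continuous_ofReal.comp Complex.continuous_re).tendsto _).comp hω
  exact tendsto_nhds_unique hω h2

end JointSpectralMeasure

section PairSubmodule

open Filter Topology ComplexConjugate UniformSpace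

theorem prodMap_mem_of_mem_closure_adjoin {H : Type*} [NormedAddCommGroup H] [NormedSpace ℂ H]
    {S : Set (H →L[ℂ] H)} {Z : Submodule ℂ (H × H)} (hZ : IsClosed (Z : Set (H × H)))
    (hS : ∀ a ∈ S, ∀ z ∈ Z, (a z.1, a z.2) ∈ Z) {a : H →L[ℂ] H}
    (ha : a ∈ closure (Algebra.adjoin ℂ S : Set (H →L[ℂ] H))) {z : H × H} (hz : z ∈ Z) :
    (a z.1, a z.2) ∈ Z := by
  have hadj : ∀ b ∈ Algebra.adjoin ℂ S, ∀ z ∈ Z, (b z.1, b z.2) ∈ Z := by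
    intro b hb
    induction hb using Algebra.adjoin_induction with
    | mem b hb => exact hS b hb
    | algebraMap r =>
      intro z hz
      simpa [Algebra.algebraMap_eq_smul_one] using! Z.smul_mem r hz
    | add b c _ _ hb hc => exact fun z hz => Z.add_mem (hb z hz) (hc z hz)
    | mul b c _ _ hb hc => exact fun z hz => hb _ (hc z hz)
  have hcl : IsClosed {b : H →L[ℂ] H | (b z.1, b z.2) ∈ Z} :=
    hZ.preimage (f := fun b : H →L[ℂ] H => (b z.1, b z.2)) (by fun_prop)
  exact closure_minimal (fun b hb => hadj b hb z hz) hcl ha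

variable {E : Type*} [SeminormedAddCommGroup E] [InnerProductSpace ℂ E] {n : ℕ}
  (M : MvPolynomial (Fin n) ℂ →ₐ[ℂ] Module.End ℂ E) (e : E)

/-- The closure of the set of pairs `(M p e, M (g * p) e)`. -/
noncomputable def pairSubmodule (g : MvPolynomial (Fin n) ℂ) :
    Submodule ℂ (Completion E × Completion E) :=
  (Submodule.span ℂ (Set.range fun p : MvPolynomial (Fin n) ℂ =>
    (((M p e : E) : Completion E), ((M (g * p) e : E) : Completion E)))).topologicalClosure

variable {M e} {g : MvPolynomial (Fin n) ℂ}

theorem mem_pairSubmodule (p : MvPolynomial (Fin n) ℂ) :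
    (((M p e : E) : Completion E), ((M (g * p) e : E) : Completion E)) ∈ pairSubmodule M e g :=
  Submodule.le_topologicalClosure _ (Submodule.subset_span ⟨p, rfl⟩)

theorem isClosed_pairSubmodule :
    IsClosed (pairSubmodule M e g : Set (Completion E × Completion E)) :=
  Submodule.isClosed_topologicalClosure _

theorem re_inner_nonneg_of_mem_pairSubmodule
    (h : ∀ p, 0 ≤ (inner ℂ (M p e) (M (g * p) e)).re) {z : Completion E × Completion E}
    (hz : z ∈ pairSubmodule M e g) : 0 ≤ (inner ℂ z.1 z.2).re := by
  have hcl : IsClosed {z : Completion E × Completion E | 0 ≤ (inner ℂ z.1 z.2).re} :=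
    isClosed_le continuous_const (by fun_prop)
  refine closure_minimal (fun z hz => ?_) hcl hz
  have hspan : ∃ p, (((M p e : E) : Completion E), ((M (g * p) e : E) : Completion E)) = z := by
    induction hz using Submodule.span_induction with
    | mem z hz => exact hz
    | zero => exact ⟨0, by simp [Completion.coe_zero]⟩
    | add z w _ _ hz hw =>
      obtain ⟨p, rfl⟩ := hz
      obtain ⟨q, rfl⟩ := hw
      exact ⟨p + q, by simp [mul_add, Completion.coe_add]⟩
    | smul a z _ hz =>
      obtain ⟨p, rfl⟩ := hz
      exact ⟨a • p, by simp [Completion.coe_smul]⟩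
  obtain ⟨p, rfl⟩ := hspan
  simpa using h p

theorem prodMap_mem_pairSubmodule {q : MvPolynomial (Fin n) ℂ}
    {A : Completion E →L[ℂ] Completion E} {a : ℕ → ℂ}
    (hA : ∀ p : E, HasSum (fun k => a k • (((M q ^ k) p : E) : Completion E)) (A p))
    {z : Completion E × Completion E} (hz : z ∈ pairSubmodule M e g) :
    (A z.1, A z.2) ∈ pairSubmodule M e g := by
  have hle : pairSubmodule M e g ≤ (pairSubmodule M e g).comap (A.prodMap A).toLinearMap := by
    refine Submodule.topologicalClosure_minimal _ (Submodule.span_le.mpr ?_)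
      (isClosed_pairSubmodule.preimage (A.prodMap A).continuous)
    rintro _ ⟨p, rfl⟩
    refine isClosed_pairSubmodule.mem_of_tendsto ((hA (M p e)).prodMk (hA (M (g * p) e)))
      (Eventually.of_forall fun s => Submodule.sum_mem _ fun k _ => ?_)
    have := (pairSubmodule M e g).smul_mem (a k) (mem_pairSubmodule (q ^ k * p))
    rw [show g * (q ^ k * p) = q ^ k * (g * p) by ring] at this
    simpa only [map_mul, map_pow, Module.End.mul_apply, Prod.smul_mk] using this
  exact hle hz

end PairSubmodule

section MomentTheorem

open Filter Topology ComplexConjugate UniformSpace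

variable {E : Type*} [SeminormedAddCommGroup E] [InnerProductSpace ℂ E] {n : ℕ}

theorem exists_measure_of_analytic (M : MvPolynomial (Fin n) ℂ →ₐ[ℂ] Module.End ℂ E) (e : E)
    (hsymm : ∀ i p q, inner ℂ (M (X i) p) q = inner ℂ p (M (X i) q)) {t : ℝ} (ht : 0 < t)
    (hs : ∀ i p, Summable fun k : ℕ => t ^ k / k.factorial * ‖(M (X i) ^ k) p‖) :
    ∃ μ : Measure (Fin n → ℝ), IsFiniteMeasure μ ∧
      (∀ p : MvPolynomial (Fin n) ℂ, Integrable (fun x => eval (fun i => (x i : ℂ)) p) μ ∧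
        ∫ x, eval (fun i => (x i : ℂ)) p ∂μ = inner ℂ e (M p e)) ∧
      ∀ g : MvPolynomial (Fin n) ℝ,
        (∀ p, 0 ≤ (inner ℂ (M p e) (M (g.map Complex.ofRealHom * p) e)).re) →
        ∀ᵐ x ∂μ, 0 ≤ eval x g := by
  choose A c hc hsum hA hlim using fun i => exists_sin_operators (hsymm i) ht (hs i)
  have hcomm : ∀ i j, Commute (M (X i)) (M (X j)) := fun i j =>
    (Commute.all (X i) (X j)).map M
  obtain ⟨Ω, _, _, _, Φ, hf, hcl⟩ := exists_continuous_functional_calculus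
    (Set.range fun k : Fin n × ℕ => A k.1 k.2)
    (by rintro _ ⟨k, rfl⟩; exact isSelfAdjoint_of_hasSum (hsymm _) (hc _ _) (hA _ _))
    (by
      rintro _ ⟨k, rfl⟩ _ ⟨l, rfl⟩
      exact commute_of_hasSum (hsymm _) (hsymm _) (hcomm _ _) (hc _ _) (hc _ _) (hA _ _)
        (hA _ _) (hsum _ _) (hsum _ _))
  choose f hf using fun i j => hf (A i j) ⟨(i, j), rfl⟩
  let _ : MeasurableSpace Ω := borel Ω
  have : BorelSpace Ω := ⟨rfl⟩
  obtain ⟨P, hP, hreg, V, hV⟩ := exists_spectral_isometry Φ (e : Completion E)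
  have hx : ∀ i, ∃ x : Ω → ℝ, Measurable x ∧
      TendstoInMeasure P (fun j => ⇑(ofRealC (f i j))) atTop fun ω => (x ω : ℂ) := fun i =>
    exists_real_limit_of_tendsto hV (by simpa only [hf] using hlim i e)
  choose x hxm hx using hx
  have hone : (ContinuousMap.toLp 2 P ℂ (1 : C(Ω, ℂ)) : Ω → ℂ) =ᵐ[P] fun _ => 1 :=
    ContinuousMap.coeFn_toLp (p := 2) (𝕜 := ℂ) P (1 : C(Ω, ℂ))
  have hV1 : V (ContinuousMap.toLp 2 P ℂ 1) = e := by simp [hV]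
  have hpoly : ∀ p : MvPolynomial (Fin n) ℂ, ∃ w : Lp ℂ 2 P, V w = ((M p e : E) : Completion E) ∧
      w =ᵐ[P] fun ω => eval (fun i => (x i ω : ℂ)) p := by
    intro p
    induction p using MvPolynomial.induction_on with
    | C a =>
      refine ⟨a • ContinuousMap.toLp 2 P ℂ 1, ?_, ?_⟩
      · rw [map_smul, hV1, ← algebraMap_eq, AlgHom.commutes, Module.algebraMap_end_apply,
          Completion.coe_smul]
      · filter_upwards [hone, Lp.coeFn_smul a (ContinuousMap.toLp 2 P ℂ (1 : C(Ω, ℂ)))]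
          with ω h1 h2
        rw [h2, Pi.smul_apply, h1, eval_C, smul_eq_mul, mul_one]
    | add p q hp hq =>
      obtain ⟨u, hu, hu'⟩ := hp
      obtain ⟨w, hw, hw'⟩ := hq
      refine ⟨u + w, by rw [map_add, map_add, hu, hw, LinearMap.add_apply, Completion.coe_add], ?_⟩
      filter_upwards [hu', hw', Lp.coeFn_add u w] with ω h1 h2 h3
      rw [h3, Pi.add_apply, h1, h2, map_add]
    | mul_X p i hp =>
      obtain ⟨u, hu, hu'⟩ := hp
      obtain ⟨w, hw, hw'⟩ := spectral_isometry_mul_of_tendsto hV (hx i) (u := u)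
        (v := (M (p * X i) e : E)) (by
          simp only [hf, hu]
          rw [mul_comm, map_mul, Module.End.mul_apply]
          exact hlim i (M p e))
      refine ⟨w, hw, ?_⟩
      filter_upwards [hu', hw'] with ω h1 h2
      rw [h2, h1, map_mul, eval_X, mul_comm]
  have hxm' : Measurable fun ω i => x i ω := measurable_pi_lambda _ hxm
  have heval : ∀ p : MvPolynomial (Fin n) ℂ,
      Continuous fun x : Fin n → ℝ => eval (fun i => (x i : ℂ)) p := fun p =>
    (continuous_eval p).comp (by fun_prop)
  have hint : ∀ p : MvPolynomial (Fin n) ℂ,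
      Integrable (fun ω => eval (fun i => (x i ω : ℂ)) p) P := fun p => by
    obtain ⟨w, -, hw⟩ := hpoly p
    exact ((Lp.memLp w).integrable one_le_two).congr hw
  refine ⟨P.map fun ω i => x i ω, inferInstance, fun p => ⟨?_, ?_⟩, fun g hg => ?_⟩
  · exact (integrable_map_measure (heval p).aestronglyMeasurable hxm'.aemeasurable).mpr (hint p)
  · rw [integral_map hxm'.aemeasurable (heval p).aestronglyMeasurable]
    obtain ⟨w, hw, hw'⟩ := hpoly p
    rw [← Completion.inner_coe, ← hw, ← hV1, V.inner_map_map, L2.inner_def]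
    refine integral_congr_ae ?_
    filter_upwards [hone, hw'] with ω h1 h2
    rw [h1, h2, RCLike.inner_apply, map_one, mul_one]
  · have hgc : ∀ ω, eval (fun i => (x i ω : ℂ)) (g.map Complex.ofRealHom) =
        (eval (fun i => x i ω) g : ℂ) := fun ω => by
      rw [eval_map]
      exact (eval₂_comp_left Complex.ofRealHom (RingHom.id ℝ) (fun i => x i ω) g).symm
    have hgm : Measurable fun ω => eval (fun i => x i ω) g :=
      (continuous_eval g).measurable.comp hxm'
    rw [ae_map_iff hxm'.aemeasurable
      (measurableSet_le measurable_const (continuous_eval g).measurable)]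
    refine ae_nonneg_of_forall_integral_sq_mul hgm ?_ fun φ => ?_
    · have := (hint (g.map Complex.ofRealHom)).re
      simpa only [hgc, RCLike.re_eq_complex_re, Complex.ofReal_re] using this
    · obtain ⟨w, hw, hw'⟩ := hpoly (g.map Complex.ofRealHom)
      have hmem : MemLp (fun ω => ofRealC φ ω * w ω) 2 P :=
        (Lp.memLp w).of_le_mul (c := ‖ofRealC φ‖)
          ((ofRealC φ).continuous.aestronglyMeasurable.mul (Lp.aestronglyMeasurable w))
          (Eventually.of_forall fun ω => by
            rw [norm_mul]
            gcongr
            exact (ofRealC φ).norm_coe_le_norm ω)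
      have hpair := prodMap_mem_of_mem_closure_adjoin
        (isClosed_pairSubmodule (M := M) (e := e) (g := g.map Complex.ofRealHom))
        (by rintro _ ⟨k, rfl⟩ z hz; exact prodMap_mem_pairSubmodule (hA _ _) hz)
        (hcl (ofRealC φ)) (mem_pairSubmodule 1)
      have hnonneg := re_inner_nonneg_of_mem_pairSubmodule hg hpair
      simp only [map_one, mul_one, Module.End.one_apply] at hnonneg
      rw [← hV, ← hw, ← spectral_isometry_mul hV (ofRealC φ) hmem.coeFn_toLp, V.inner_map_map,
        L2.inner_def] at hnonneg
      have hφ := ContinuousMap.coeFn_toLp (p := 2) (𝕜 := ℂ) P (ofRealC φ)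
      have heq : ∫ ω, inner ℂ (ContinuousMap.toLp 2 P ℂ (ofRealC φ) ω) (hmem.toLp _ ω) ∂P =
          ((∫ ω, φ ω ^ 2 * eval (fun i => x i ω) g ∂P : ℝ) : ℂ) := by
        rw [← integral_complex_ofReal]
        refine integral_congr_ae ?_
        filter_upwards [hφ, hw', hmem.coeFn_toLp] with ω h1 h2 h3
        rw [h1, h3, h2, hgc]
        simp [ofRealC]
        ring
      rwa [heq, Complex.ofReal_re] at hnonneg

end MomentTheorem

section GNS

open ComplexConjugate

variable {n : ℕ}

/-- The `ℂ`-linear extension of a real functional on polynomials. -/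
noncomputable def complexExtension (L : MvPolynomial (Fin n) ℝ →ₗ[ℝ] ℝ) :
    MvPolynomial (Fin n) ℂ →ₗ[ℂ] ℂ :=
  (basisMonomials (Fin n) ℂ).constr ℂ fun α => (L (monomial α 1) : ℂ)

variable (L : MvPolynomial (Fin n) ℝ →ₗ[ℝ] ℝ)

theorem complexExtension_monomial (α : Fin n →₀ ℕ) (c : ℂ) :
    complexExtension L (monomial α c) = c * L (monomial α 1) := by
  have h : monomial α c = c • basisMonomials (Fin n) ℂ α := by
    simp [coe_basisMonomials, smul_monomial]
  rw [h, map_smul, complexExtension, Module.Basis.constr_basis, smul_eq_mul]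

theorem complexExtension_map (p : MvPolynomial (Fin n) ℝ) :
    complexExtension L (p.map Complex.ofRealHom) = L p := by
  induction p using MvPolynomial.induction_on' with
  | monomial α c =>
    have h : monomial α c = c • monomial α (1 : ℝ) := by simp [smul_monomial]
    rw [map_monomial, complexExtension_monomial, h, map_smul]
    simp
  | add p q hp hq => simp [hp, hq]

theorem complexExtension_conj (p : MvPolynomial (Fin n) ℂ) :
    complexExtension L (p.map (starRingEnd ℂ)) = conj (complexExtension L p) := by
  induction p using MvPolynomial.induction_on' with
  | monomial α c => simp [complexExtension_monomial]
  | add p q hp hq => simp [hp, hq]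

theorem map_conj_map_conj (p : MvPolynomial (Fin n) ℂ) :
    (p.map (starRingEnd ℂ)).map (starRingEnd ℂ) = p := by
  rw [map_map]
  convert map_id p
  ext z
  simp

theorem map_conj_map_ofReal (p : MvPolynomial (Fin n) ℝ) :
    (p.map Complex.ofRealHom).map (starRingEnd ℂ) = p.map Complex.ofRealHom := by
  rw [map_map]
  congr 2
  ext z
  simp

theorem exists_re_im (p : MvPolynomial (Fin n) ℂ) :
    ∃ a b : MvPolynomial (Fin n) ℝ,
      p = a.map Complex.ofRealHom + C Complex.I * b.map Complex.ofRealHom := by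
  induction p using MvPolynomial.induction_on' with
  | monomial α c =>
    refine ⟨monomial α c.re, monomial α c.im, ?_⟩
    rw [map_monomial, map_monomial, C_mul_monomial, ← map_add, Complex.ofRealHom_eq_coe,
      Complex.ofRealHom_eq_coe, mul_comm, Complex.re_add_im]
  | add p q hp hq =>
    obtain ⟨a, b, rfl⟩ := hp
    obtain ⟨c, d, rfl⟩ := hq
    exact ⟨a + c, b + d, by simp only [map_add]; ring⟩

theorem re_complexExtension_nonneg {g : MvPolynomial (Fin n) ℝ} (hg : ∀ h, 0 ≤ L (h ^ 2 * g))
    (p : MvPolynomial (Fin n) ℂ) :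
    0 ≤ (complexExtension L (p.map (starRingEnd ℂ) * (g.map Complex.ofRealHom * p))).re := by
  obtain ⟨a, b, rfl⟩ := exists_re_im p
  have hI : (C Complex.I * C Complex.I : MvPolynomial (Fin n) ℂ) = -1 := by
    rw [← C_mul, Complex.I_mul_I, C_neg, C_1]
  have h : (a.map Complex.ofRealHom + C Complex.I * b.map Complex.ofRealHom).map (starRingEnd ℂ) *
      (g.map Complex.ofRealHom * (a.map Complex.ofRealHom + C Complex.I * b.map Complex.ofRealHom))
      = (a ^ 2 * g + b ^ 2 * g).map Complex.ofRealHom := by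
    simp only [map_add, map_mul, map_pow, map_conj_map_ofReal, map_C, Complex.conj_I, C_neg]
    linear_combination -(b.map Complex.ofRealHom) ^ 2 * g.map Complex.ofRealHom * hI
  rw [h, complexExtension_map, Complex.ofReal_re, map_add]
  exact add_nonneg (hg a) (hg b)

/-- The Gelfand–Naimark–Segal inner product of a functional that is nonnegative on squares. -/
noncomputable abbrev gnsCore (hL : ∀ h, 0 ≤ L (h ^ 2)) :
    PreInnerProductSpace.Core ℂ (MvPolynomial (Fin n) ℂ) where
  inner p q := complexExtension L (p.map (starRingEnd ℂ) * q)
  conj_inner_symm p q := by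
    rw [← complexExtension_conj, map_mul, map_conj_map_conj, mul_comm]
  re_inner_nonneg p := by
    have := re_complexExtension_nonneg L (g := 1) (by simpa using hL) p
    rwa [map_one, one_mul] at this
  add_left p q r := by rw [map_add, add_mul, map_add]
  smul_left p q c := by
    rw [smul_eq_C_mul, (map _).map_mul, map_C, mul_assoc, ← smul_eq_C_mul, map_smul, smul_eq_mul]

theorem factorial_two_mul_add_le (k b : ℕ) :
    (2 * k + b).factorial ≤ 2 ^ b * b.factorial * (4 ^ k * k.factorial) ^ 2 := by
  have h1 := Nat.add_choose_mul_factorial_mul_factorial (2 * k) b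
  have h2 := Nat.add_choose_mul_factorial_mul_factorial k k
  rw [← two_mul] at h2
  rw [← h1, ← h2]
  calc _ ≤ 2 ^ (2 * k + b) * (2 ^ (2 * k) * k.factorial * k.factorial) * b.factorial := by
        gcongr <;> exact Nat.choose_le_two_pow _ _
    _ = _ := by
        rw [show 4 = 2 ^ 2 by rfl, ← pow_mul]; ring

theorem exists_measure_of_factorial_bound (hL : ∀ h, 0 ≤ L (h ^ 2)) {D : ℝ}
    (hD : ∀ α : Fin n →₀ ℕ, L (monomial α 1) ≤ D * (α.degree + 1).factorial) :
    ∃ μ : Measure (Fin n → ℝ), IsFiniteMeasure μ ∧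
      (∀ p : MvPolynomial (Fin n) ℝ, Integrable (fun x => eval x p) μ ∧
        ∫ x, eval x p ∂μ = L p) ∧
      ∀ g, (∀ h, 0 ≤ L (h ^ 2 * g)) → ∀ᵐ x ∂μ, 0 ≤ eval x g := by
  let core := gnsCore L hL
  let _ : SeminormedAddCommGroup (MvPolynomial (Fin n) ℂ) :=
    InnerProductSpace.Core.toSeminormedAddCommGroup (𝕜 := ℂ) (c := core)
  let _ : InnerProductSpace ℂ (MvPolynomial (Fin n) ℂ) := InnerProductSpace.ofCore core
  have hinner : ∀ p q : MvPolynomial (Fin n) ℂ,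
      inner ℂ p q = complexExtension L (p.map (starRingEnd ℂ) * q) := fun p q => rfl
  have hnorm : ∀ p : MvPolynomial (Fin n) ℝ, ‖p.map Complex.ofRealHom‖ ^ 2 = L (p ^ 2) := by
    intro p
    rw [@norm_sq_eq_re_inner ℂ, hinner, map_conj_map_ofReal, ← map_mul, complexExtension_map,
      ← sq]
    rfl
  let A : MvPolynomial (Fin n) ℂ →ₐ[ℂ] Module.End ℂ (MvPolynomial (Fin n) ℂ) :=
    Algebra.lmul ℂ _
  have hA : ∀ p q, A p q = p * q := fun _ _ => rfl
  have hApow : ∀ i k q, (A (X i) ^ k) q = X i ^ k * q := fun i k q => by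
    rw [← map_pow, hA]
  have hsum : ∀ i p, Summable fun k : ℕ => (1 / 8 : ℝ) ^ k / k.factorial * ‖(A (X i) ^ k) p‖ := by
    intro i p
    simp only [hApow]
    induction p using MvPolynomial.induction_on' with
    | monomial α c =>
      set b := 2 * α.degree + 1
      have hD0 : 0 ≤ D := by
        have h1 := (hL 1).trans_eq (by rw [one_pow])
        have h2 := hD 0
        simp only [map_zero, zero_add, Nat.factorial_one, Nat.cast_one, mul_one] at h2
        exact h1.trans h2
      have hbd : ∀ k : ℕ, ‖X i ^ k * monomial α c‖ ≤
          ‖c‖ * (√(D * (2 ^ b * b.factorial)) * (4 ^ k * k.factorial)) := by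
        intro k
        have h : (X i ^ k * monomial α c : MvPolynomial (Fin n) ℂ) =
            c • (monomial (Finsupp.single i k + α) (1 : ℝ)).map Complex.ofRealHom := by
          rw [X_pow_eq_monomial, monomial_mul, map_monomial, smul_monomial]
          simp
        rw [h, norm_smul]
        gcongr
        refine abs_le_of_sq_le_sq' ?_ (by positivity) |>.2
        rw [hnorm, monomial_pow, one_pow, mul_pow, Real.sq_sqrt (by positivity)]
        refine (hD _).trans ?_
        have hdeg : (2 • (Finsupp.single i k + α)).degree + 1 = 2 * k + b := by
          rw [two_nsmul, map_add, map_add, Finsupp.degree_single]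
          ring
        rw [hdeg, mul_assoc]
        gcongr
        exact_mod_cast factorial_two_mul_add_le k b
      refine Summable.of_nonneg_of_le (fun k => by positivity) (fun k => ?_)
        (summable_geometric_two.mul_left (‖c‖ * √(D * (2 ^ b * b.factorial))))
      calc _ ≤ (1 / 8 : ℝ) ^ k / k.factorial *
              (‖c‖ * (√(D * (2 ^ b * b.factorial)) * (4 ^ k * k.factorial))) := by
            gcongr
            exact hbd k
        _ = ‖c‖ * √(D * (2 ^ b * b.factorial)) * ((1 / 8) ^ k * 4 ^ k) := by
            field_simp
        _ = _ := by rw [← mul_pow]; norm_num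
    | add p q hp hq =>
      refine (hp.add hq).of_nonneg_of_le (fun k => by positivity) fun k => ?_
      rw [← mul_add, mul_add (X i ^ k)]
      gcongr
      exact norm_add_le _ _
  obtain ⟨μ, hμ, hint, hnonneg⟩ := exists_measure_of_analytic A 1
    (fun i p q => by rw [hinner, hinner, hA, hA, (map _).map_mul, map_X]; congr 1; ring)
    (by norm_num) hsum
  refine ⟨μ, hμ, fun p => ?_, fun g hg => hnonneg g fun p => ?_⟩
  · obtain ⟨h1, h2⟩ := hint (p.map Complex.ofRealHom)
    have heval : ∀ x : Fin n → ℝ, eval (fun i => (x i : ℂ)) (p.map Complex.ofRealHom) =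
        (eval x p : ℂ) := fun x => by
      rw [eval_map]
      exact (eval₂_comp_left Complex.ofRealHom (RingHom.id ℝ) x p).symm
    simp only [heval] at h1 h2
    refine ⟨by simpa using h1.re, ?_⟩
    rw [integral_complex_ofReal, hinner, hA, map_one, one_mul, mul_one, complexExtension_map] at h2
    exact_mod_cast h2
  · rw [hinner, hA, hA, mul_one, mul_one]
    exact re_complexExtension_nonneg L hg p

end GNS

theorem Lfun_eq_constr {n : ℕ} (y : (Fin n →₀ ℕ) → ℝ) (f : MvPolynomial (Fin n) ℝ) :
    Lfun y f = (basisMonomials (Fin n) ℝ).constr ℝ y f := by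
  rw [Module.Basis.constr_apply]
  rfl

theorem msupport_subset_of_ae {n : ℕ} {μ : Measure (Fin n → ℝ)} {K : Set (Fin n → ℝ)}
    (hK : IsClosed K) (h : ∀ᵐ x ∂μ, x ∈ K) : msupport μ ⊆ K := by
  intro x hx
  by_contra hxK
  exact hx Kᶜ hK.isOpen_compl hxK h

theorem stmt3 {n m : ℕ} (g : Fin m → MvPolynomial (Fin n) ℝ)
    (K : Set (Fin n → ℝ)) (hK : K = {x | ∀ j, 0 ≤ eval x (g j)})
    (y : (Fin n →₀ ℕ) → ℝ)
    (hpos0 : ∀ h : MvPolynomial (Fin n) ℝ, 0 ≤ Lfun y (h ^ 2))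
    (hpos : ∀ (h : MvPolynomial (Fin n) ℝ) (j : Fin m), 0 ≤ Lfun y (h ^ 2 * g j))
    (M : ℝ) (hM : 0 < M)
    (hbound : ∀ α : Fin n →₀ ℕ,
      |y α| ≤ M * (2 * (((α.sum fun _ e => e) + 1) / 2)).factorial) :
    ∃ μ : Measure (Fin n → ℝ), IsFiniteMeasure μ ∧ msupport μ ⊆ K ∧
      ∀ α : Fin n →₀ ℕ, Integrable (fun x => ∏ i, x i ^ α i) μ ∧
        y α = ∫ x, ∏ i, x i ^ α i ∂μ := by
  simp only [Lfun_eq_constr] at hpos0 hpos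
  have hmon : ∀ α, (basisMonomials (Fin n) ℝ).constr ℝ y (monomial α 1) = y α := fun α => by
    simpa [coe_basisMonomials] using (basisMonomials (Fin n) ℝ).constr_basis ℝ y α
  obtain ⟨μ, hμ, hint, hnonneg⟩ := exists_measure_of_factorial_bound _ hpos0 (D := M) fun α => by
    rw [hmon]
    refine (le_abs_self _).trans ((hbound α).trans ?_)
    gcongr
    exact Nat.mul_div_le _ 2
  refine ⟨μ, hμ, msupport_subset_of_ae ?_ ?_, fun α => ?_⟩
  · rw [hK, Set.ofPred_forall]
    exact isClosed_iInter fun j => isClosed_le continuous_const (continuous_eval (g j))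
  · rw [hK]
    exact ae_all_iff.mpr fun j => hnonneg (g j) fun h => hpos h j
  · have heval : ∀ x : Fin n → ℝ, eval x (monomial α 1) = ∏ i, x i ^ α i := fun x => by
      rw [eval_monomial, one_mul, Finsupp.prod_fintype _ _ fun i => pow_zero _]
    obtain ⟨h1, h2⟩ := hint (monomial α 1)
    simp only [heval, hmon] at h1 h2
    exact ⟨h1, h2.symm⟩
end
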